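/- Suppose m = m(n) with m, n → ∞, let p = p(n) := m/C(n,2), and assume liminf_n p(n) > 0. For each n fix three distinct vertices s, a, b of ⃗G(n,m). Then P(s↛a and b↛s) = 3·q(2n−3; n, m) + o((1−p/2)^{2n}), and consequently P(s↛a and b↛s) ∼ 3(1 − p/2)^{2n−3}·exp(−4p(1−p)/(2−p)²), i.e. the ratio of the two sides tends to 1 as n → ∞. -/

import Mathlib

open Filter Real

/-- Edges of the complete graph on `Fin n`: ordered pairs `(u,v)` with `u < v`. -/
abbrev Edge (n : ℕ) : Type := {e : Fin n × Fin n // e.1 < e.2}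

/-- A configuration of the random edge-orientation model: for each pair `u < v`,
`none` means no edge, `some true` means the directed edge `u → v`, and
`some false` means the directed edge `v → u`. -/
abbrev Config (n : ℕ) : Type := Edge n → Option Bool

/-- The directed edge relation determined by a configuration. -/
def DirEdge {n : ℕ} (f : Config n) (u v : Fin n) : Prop :=
  (∃ h : u < v, f ⟨(u, v), h⟩ = some true) ∨ (∃ h : v < u, f ⟨(v, u), h⟩ = some false)

/-- `Reaches f u v`: the configuration `f` contains a directed path from `u` to `v`
(paths of length `0` are allowed, so `Reaches f u u` always holds). -/
def Reaches {n : ℕ} (f : Config n) (u v : Fin n) : Prop :=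
  Relation.ReflTransGen (DirEdge f) u v

/-- The probability of an event under a weight function on a finite sample space. -/
noncomputable def prWeight {α : Type*} [Fintype α] (w : α → ℝ) (E : Set α) : ℝ :=
  ∑ x, E.indicator w x

/-- The weight of one edge state in `⃗G(n,p)`: no edge has probability `1 - p`
and each of the two orientations has probability `p/2`. -/
noncomputable def edgeWeight (p : ℝ) : Option Bool → ℝ
  | none => 1 - p
  | some _ => p / 2

/-- The probability of an event in the random directed graph `⃗G(n,p)`. -/
noncomputable def PrGnp (n : ℕ) (p : ℝ) (E : Set (Config n)) : ℝ :=
  prWeight (fun f => ∏ e : Edge n, edgeWeight p (f e)) E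

/-- The number of present edges of a configuration. -/
def edgeCount {n : ℕ} (f : Config n) : ℕ :=
  (Finset.univ.filter fun e : Edge n => (f e).isSome).card

/-- The probability of an event in the random directed graph `⃗G(n,m)`:
the underlying graph is uniform among the graphs with exactly `m` edges, and each
present edge is oriented in one of its two directions with probability `1/2`,
independently over edges. -/
noncomputable def PrGnm (n m : ℕ) (E : Set (Config n)) : ℝ :=
  prWeight (fun f => if edgeCount f = m
      then ((Nat.choose (Nat.choose n 2) m : ℝ) * 2 ^ m)⁻¹ else 0) E

section Counting

lemma card_edge (n : ℕ) : Fintype.card (Edge n) = n.choose 2 := by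
  rw [Fintype.card_subtype]
  have h : (Finset.univ.filter fun e : Fin n × Fin n => e.1 < e.2) =
      (Finset.univ.sigma (fun v : Fin n => Finset.Iio v)).map
        ⟨fun x => (x.2, x.1), fun x y h => by cases x; cases y; simp_all⟩ := by
    ext ⟨u, v⟩
    simp only [Finset.mem_filter, Finset.mem_univ, true_and, Finset.mem_map, Finset.mem_sigma,
      Finset.mem_Iio]
    exact ⟨fun h => ⟨⟨v, u⟩, h, rfl⟩, by rintro ⟨x, hx, h⟩; cases h; exact hx⟩
  rw [h, Finset.card_map, Finset.card_sigma]
  simp only [Fin.card_Iio]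
  rw [Fin.sum_univ_eq_sum_range (fun i => i), Finset.sum_range_id, Nat.choose_two_right]

lemma prWeight_union_le {α : Type*} [Fintype α] {w : α → ℝ} (hw : ∀ x, 0 ≤ w x) (E E' : Set α) :
    prWeight w (E ∪ E') ≤ prWeight w E + prWeight w E' := by
  unfold prWeight
  rw [← Finset.sum_add_distrib]
  refine Finset.sum_le_sum fun x _ => ?_
  by_cases h : x ∈ E <;> by_cases h' : x ∈ E' <;> simp [h, h', hw x]

lemma prWeight_iUnion_le {α ι : Type*} [Fintype α] {w : α → ℝ} (hw : ∀ x, 0 ≤ w x)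
    (I : Finset ι) (E : ι → Set α) :
    prWeight w {x | ∃ i ∈ I, x ∈ E i} ≤ ∑ i ∈ I, prWeight w (E i) := by
  unfold prWeight
  rw [Finset.sum_comm]
  refine Finset.sum_le_sum fun x _ => ?_
  have h0 : ∀ i ∈ I, 0 ≤ (E i).indicator w x := fun i _ => Set.indicator_nonneg (fun y _ => hw y) x
  by_cases h : x ∈ {x | ∃ i ∈ I, x ∈ E i}
  · obtain ⟨i, hi, hx⟩ := h
    rw [Set.indicator_of_mem (show x ∈ {x | ∃ i ∈ I, x ∈ E i} from ⟨i, hi, hx⟩)]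
    calc w x = (E i).indicator w x := (Set.indicator_of_mem hx w).symm
      _ ≤ _ := Finset.single_le_sum h0 hi
  · rw [Set.indicator_of_notMem h]
    exact Finset.sum_nonneg h0

lemma prWeight_finset {α : Type*} [Fintype α] [DecidableEq α] (w : α → ℝ) (S : Finset α) :
    prWeight w (S : Set α) = ∑ x ∈ S, w x := by
  unfold prWeight
  simp [Set.indicator_apply]

/-- The weight of a configuration in `⃗G(n,m)` is nonnegative. -/
lemma gnm_weight_nonneg {n m : ℕ} (f : Config n) :
    0 ≤ (if edgeCount f = m
      then ((Nat.choose (Nat.choose n 2) m : ℝ) * 2 ^ m)⁻¹ else 0) := by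
  split_ifs <;> positivity

lemma edgeWeight_nonneg {p : ℝ} (h0 : 0 ≤ p) (h1 : p ≤ 1) (c : Option Bool) :
    0 ≤ edgeWeight p c := by
  cases c
  · simpa [edgeWeight] using h1
  · exact div_nonneg h0 zero_le_two

lemma gnp_weight_nonneg {n : ℕ} {p : ℝ} (h0 : 0 ≤ p) (h1 : p ≤ 1) (f : Config n) :
    0 ≤ ∏ e : Edge n, edgeWeight p (f e) :=
  Finset.prod_nonneg fun _ _ => edgeWeight_nonneg h0 h1 _

lemma prod_edgeWeight {n : ℕ} (p : ℝ) (f : Config n) :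
    ∏ e : Edge n, edgeWeight p (f e) =
      (p / 2) ^ edgeCount f * (1 - p) ^ (n.choose 2 - edgeCount f) := by
  have h : ∀ e : Edge n, edgeWeight p (f e) = if (f e).isSome then p / 2 else 1 - p := by
    intro e
    cases f e <;> simp [edgeWeight]
  simp only [h]
  rw [Finset.prod_ite, Finset.prod_const, Finset.prod_const, ← Finset.compl_filter,
    Finset.card_compl, card_edge]
  rfl

open Polynomial in
/-- Generating function of configurations in a product set by number of edges. -/
lemma sum_X_pow_edgeCount {n : ℕ} (S : Edge n → Finset (Option Bool)) :
    ∑ f ∈ Fintype.piFinset S, (X : ℝ[X]) ^ edgeCount f =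
      ∏ e, ∑ c ∈ S e, (X : ℝ[X]) ^ (if c.isSome then 1 else 0) := by
  rw [Finset.prod_univ_sum]
  refine Finset.sum_congr rfl fun f _ => ?_
  rw [Finset.prod_pow_eq_pow_sum, edgeCount, Finset.card_filter]

open Polynomial in
/-- The probability that `⃗G(n,m)` avoids a set of `ℓ` directed edges on distinct pairs. -/
lemma prGnm_avoid {n m : ℕ} (F : Finset (Edge n)) (o : Edge n → Bool) :
    PrGnm n m {f | ∀ e ∈ F, f e ≠ some (o e)} =
      (∑ k ∈ Finset.range (F.card + 1), (F.card.choose k : ℝ) * ((n.choose 2 - k).choose m : ℝ)) /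
        (2 ^ F.card * ((n.choose 2).choose m : ℝ)) := by
  classical
  set M := n.choose 2 with hM
  set ℓ := F.card with hℓ
  have hℓM : ℓ ≤ M := by
    rw [hM, ← card_edge]
    exact Finset.card_le_univ _
  let S : Edge n → Finset (Option Bool) := fun e => if e ∈ F then {some (o e)}ᶜ else Finset.univ
  have hset : {f : Config n | ∀ e ∈ F, f e ≠ some (o e)} = (Fintype.piFinset S : Set (Config n)) := by
    ext f
    simp only [Set.mem_ofPred_eq, Finset.mem_coe, Fintype.mem_piFinset, S]
    refine forall_congr' fun e => ?_
    by_cases h : e ∈ F <;> simp [h]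
  have hcoef : ((Fintype.piFinset S).filter fun f => edgeCount f = m).card =
      ((∏ e, ∑ c ∈ S e, (X : ℝ[X]) ^ (if c.isSome then 1 else 0)).coeff m) := by
    rw [← sum_X_pow_edgeCount, Polynomial.finsetSum_coeff, Finset.card_filter]
    push_cast
    refine Finset.sum_congr rfl fun f _ => ?_
    rw [Polynomial.coeff_X_pow]
    simp [eq_comm]
  have hfac : ∀ e, ∑ c ∈ S e, (X : ℝ[X]) ^ (if c.isSome then 1 else 0) =
      if e ∈ F then 1 + X else 1 + C 2 * X := by
    intro e
    have hC : (C 2 : ℝ[X]) = 2 := rfl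
    by_cases h : e ∈ F
    · have : ({some (o e)} : Finset (Option Bool))ᶜ = {none, some (!o e)} := by
        cases o e <;> decide
      simp [S, h, this]
    · simp only [S, h, if_false, Fintype.sum_option, Fintype.sum_bool, hC]
      simp
      ring
  have hprod : (∏ e, ∑ c ∈ S e, (X : ℝ[X]) ^ (if c.isSome then 1 else 0)) =
      C ((2 ^ ℓ)⁻¹) * ∑ k ∈ Finset.range (ℓ + 1), C (ℓ.choose k : ℝ) * (1 + C 2 * X) ^ (M - k) := by
    have h1 : (1 + X : ℝ[X]) = C (2⁻¹) * (1 + (1 + C 2 * X)) := by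
      rw [mul_add, mul_add, ← mul_assoc, ← C_mul]
      norm_num
      rw [← add_assoc, ← C_1, ← C_add]
      norm_num
    simp only [hfac]
    rw [Finset.prod_ite, Finset.prod_const, Finset.prod_const, Finset.filter_mem_eq_inter,
      Finset.univ_inter, h1, mul_pow, add_pow, Finset.filter_not, Finset.filter_mem_eq_inter,
      Finset.univ_inter, ← Finset.compl_eq_univ_sdiff, Finset.card_compl, card_edge, ← hM, ← hℓ,
      ← C_pow, inv_pow, mul_assoc, Finset.sum_mul]
    congr 1
    refine Finset.sum_congr rfl fun k hk => ?_
    have hk' : k ≤ ℓ := by simpa [Nat.lt_succ_iff] using hk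
    rw [one_pow, one_mul, mul_right_comm, ← pow_add, mul_comm, show ℓ - k + (M - ℓ) = M - k by omega]
    simp
  have hcoef2 : ∀ j, ((1 + C 2 * X : ℝ[X]) ^ j).coeff m = 2 ^ m * (j.choose m : ℝ) := by
    intro j
    have : (1 + C 2 * X : ℝ[X]) ^ j = ((1 + X) ^ j : ℝ[X]).comp (C 2 * X) := by simp
    rw [this, Polynomial.comp_C_mul_X_coeff, Polynomial.coeff_one_add_X_pow, mul_comm]
  rw [PrGnm, hset, prWeight_finset, ← Finset.sum_filter, Finset.sum_const, nsmul_eq_mul, hcoef,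
    hprod, Polynomial.coeff_C_mul, Polynomial.finsetSum_coeff]
  simp only [Polynomial.coeff_C_mul, hcoef2]
  rw [Finset.sum_congr rfl (fun k _ => mul_left_comm _ _ _), ← Finset.mul_sum]
  field_simp
  rw [hM]

end Counting

section Comparison

/-- The mode of the binomial distribution with parameters `M` and `m / M` is `m`. -/
lemma binomial_term_le_mode {M m : ℕ} (hm : m ≤ M) {k : ℕ} (hk : k ≤ M) :
    M.choose k * (m ^ k * (M - m) ^ (M - k)) ≤ M.choose m * (m ^ m * (M - m) ^ (M - m)) := by
  rcases le_total k m with h | h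
  · induction h using Nat.decreasingInduction with
    | self => exact le_rfl
    | of_succ k hkm ih =>
      refine le_trans ?_ (ih (by omega))
      have h1 := Nat.choose_succ_right_eq M k
      obtain ⟨d, hd⟩ : ∃ d, M - k = d + 1 := ⟨M - k - 1, by omega⟩
      have hd' : M - (k + 1) = d := by omega
      rw [hd', hd, pow_succ, pow_succ]
      rw [hd] at h1
      refine Nat.le_of_mul_le_mul_right ?_ (show 0 < k + 1 from k.succ_pos)
      have h2 : (M - m) * (k + 1) ≤ m * (d + 1) := by
        have h3 : M - m ≤ d + 1 := by omega
        have h4 : k + 1 ≤ m := hkm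
        calc (M - m) * (k + 1) ≤ (d + 1) * m := Nat.mul_le_mul h3 h4
          _ = _ := mul_comm _ _
      calc M.choose k * (m ^ k * ((M - m) ^ d * (M - m))) * (k + 1)
          = M.choose k * (m ^ k * (M - m) ^ d) * ((M - m) * (k + 1)) := by ring
        _ ≤ M.choose k * (m ^ k * (M - m) ^ d) * (m * (d + 1)) := Nat.mul_le_mul_left _ h2
        _ = (M.choose k * (d + 1)) * (m ^ k * m * (M - m) ^ d) := by ring
        _ = (M.choose (k + 1) * (k + 1)) * (m ^ k * m * (M - m) ^ d) := by rw [h1]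
        _ = _ := by ring
  · induction k, h using Nat.le_induction with
    | base => exact le_rfl
    | succ k hkm ih =>
      refine le_trans ?_ (ih (by omega))
      have h1 := Nat.choose_succ_right_eq M k
      obtain ⟨d, hd⟩ : ∃ d, M - k = d + 1 := ⟨M - k - 1, by omega⟩
      have hd' : M - (k + 1) = d := by omega
      rw [hd', hd, pow_succ, pow_succ]
      rw [hd] at h1
      refine Nat.le_of_mul_le_mul_right ?_ (show 0 < k + 1 from k.succ_pos)
      have h2 : m * (d + 1) ≤ (M - m) * (k + 1) := by
        have h3 : d + 1 ≤ M - m := by omega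
        have h4 : m ≤ k + 1 := by omega
        calc m * (d + 1) ≤ (k + 1) * (M - m) := Nat.mul_le_mul h4 h3
          _ = _ := mul_comm _ _
      calc M.choose (k + 1) * (m ^ k * m * (M - m) ^ d) * (k + 1)
          = (M.choose (k + 1) * (k + 1)) * (m ^ k * m * (M - m) ^ d) := by ring
        _ = (M.choose k * (d + 1)) * (m ^ k * m * (M - m) ^ d) := by rw [h1]
        _ = M.choose k * (m ^ k * (M - m) ^ d) * (m * (d + 1)) := by ring
        _ ≤ M.choose k * (m ^ k * (M - m) ^ d) * ((M - m) * (k + 1)) := Nat.mul_le_mul_left _ h2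
        _ = _ := by ring

lemma one_le_mul_binomial_mode {M m : ℕ} (hM : 0 < M) (hm : m ≤ M) :
    (1 : ℝ) ≤ (M + 1) * (M.choose m * (((m : ℝ) / M) ^ m * (1 - (m : ℝ) / M) ^ (M - m))) := by
  have hM' : (0 : ℝ) < M := by exact_mod_cast hM
  have hsum : (M : ℕ) ^ M ≤ (M + 1) * (M.choose m * (m ^ m * (M - m) ^ (M - m))) := by
    calc M ^ M = (m + (M - m)) ^ M := by rw [Nat.add_sub_cancel' hm]
      _ = ∑ k ∈ Finset.range (M + 1), m ^ k * (M - m) ^ (M - k) * M.choose k := add_pow _ _ _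
      _ ≤ ∑ k ∈ Finset.range (M + 1), M.choose m * (m ^ m * (M - m) ^ (M - m)) := by
          refine Finset.sum_le_sum fun k hk => ?_
          rw [mul_comm]
          exact binomial_term_le_mode hm (by simpa [Nat.lt_succ_iff] using hk)
      _ = _ := by simp
  have hsum' : (M : ℝ) ^ M ≤ (M + 1) * (M.choose m * (m ^ m * (M - m) ^ (M - m))) := by
    have := (Nat.cast_le (α := ℝ)).2 hsum
    push_cast [Nat.cast_sub hm] at this
    exact this
  have h1 : 1 - (m : ℝ) / M = (M - m) / M := by field_simp
  rw [h1, div_pow, div_pow, div_mul_div_comm, ← pow_add, Nat.add_sub_cancel' hm, ← mul_div_assoc,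
    ← mul_div_assoc, le_div_iff₀ (by positivity), one_mul]
  exact hsum'

/-- Events in `⃗G(n,m)` are at most polynomially more likely than in `⃗G(n,p)` with
`p = m / C(n,2)`. -/
lemma prGnm_le_prGnp {n m : ℕ} (hn : 0 < n.choose 2) (hm : m ≤ n.choose 2) (E : Set (Config n)) :
    PrGnm n m E ≤ (n.choose 2 + 1) * PrGnp n ((m : ℝ) / n.choose 2) E := by
  set M := n.choose 2 with hM
  have hM' : (0 : ℝ) < M := by exact_mod_cast hn
  have hp0 : 0 ≤ (m : ℝ) / M := by positivity
  have hp1 : (m : ℝ) / M ≤ 1 := div_le_one_of_le₀ (by exact_mod_cast hm) hM'.le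
  unfold PrGnm PrGnp prWeight
  rw [Finset.mul_sum]
  refine Finset.sum_le_sum fun f _ => ?_
  by_cases hf : f ∈ E
  swap
  · simp [hf]
  rw [Set.indicator_of_mem hf, Set.indicator_of_mem hf]
  split_ifs with hc
  · rw [prod_edgeWeight, hc, ← hM, inv_le_iff_one_le_mul₀ (by
      have := Nat.choose_pos hm
      positivity)]
    refine (one_le_mul_binomial_mode hn hm).trans_eq ?_
    rw [div_pow _ (2 : ℝ)]
    field_simp
  · exact mul_nonneg (by positivity) (gnp_weight_nonneg hp0 hp1 f)

/-- The number of the two orientations of the pair `e` that lie in `D`. -/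
def dirCount {n : ℕ} (D : Finset (Fin n × Fin n)) (e : Edge n) : ℕ :=
  (if e.1 ∈ D then 1 else 0) + (if e.1.swap ∈ D then 1 else 0)

lemma sum_dirCount {n : ℕ} (D : Finset (Fin n × Fin n)) (hD : ∀ x ∈ D, x.1 ≠ x.2) :
    ∑ e, dirCount D e = D.card := by
  classical
  unfold dirCount
  rw [Finset.sum_add_distrib, ← Finset.card_filter, ← Finset.card_filter,
    ← Finset.card_filter_add_card_filter_not (s := D) (fun x => x.1 < x.2)]
  congr 1
  · refine Finset.card_bij (fun e _ => e.1) ?_ ?_ ?_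
    · intro e he
      simp only [Finset.mem_filter, Finset.mem_univ, true_and] at he ⊢
      exact ⟨he, e.2⟩
    · intro e _ e' _ h
      exact Subtype.ext h
    · intro x hx
      simp only [Finset.mem_filter] at hx
      exact ⟨⟨x, hx.2⟩, by simpa using hx.1, rfl⟩
  · refine Finset.card_bij (fun e _ => e.1.swap) ?_ ?_ ?_
    · intro e he
      simp only [Finset.mem_filter, Finset.mem_univ, true_and] at he ⊢
      exact ⟨he, not_lt.2 e.2.le⟩
    · intro e _ e' _ h
      exact Subtype.ext (Prod.swap_injective h)
    · intro x hx
      simp only [Finset.mem_filter] at hx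
      exact ⟨⟨x.swap, lt_of_le_of_ne (not_lt.1 hx.2) (hD x hx.1).symm⟩, by simpa using hx.1,
        by simp⟩

/-- The configurations containing none of the directed edges in `D`. -/
def avoids {n : ℕ} (D : Finset (Fin n × Fin n)) : Set (Config n) :=
  {f | ∀ x ∈ D, ¬ DirEdge f x.1 x.2}

lemma mem_avoids {n : ℕ} (D : Finset (Fin n × Fin n)) (f : Config n) :
    f ∈ avoids D ↔ ∀ e : Edge n, (e.1 ∈ D → f e ≠ some true) ∧
      (e.1.swap ∈ D → f e ≠ some false) := by
  constructor
  · intro h e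
    refine ⟨fun he hf => h _ he (Or.inl ⟨e.2, hf⟩), fun he hf => h _ he (Or.inr ⟨e.2, hf⟩)⟩
  · rintro h ⟨u, v⟩ hx (⟨huv, hf⟩ | ⟨huv, hf⟩)
    · exact (h ⟨(u, v), huv⟩).1 hx hf
    · exact (h ⟨(v, u), huv⟩).2 hx hf

lemma prGnp_avoids_le {n : ℕ} {p σ : ℝ} (h0 : 0 ≤ p) (h1 : p ≤ 1)
    (D : Finset (Fin n × Fin n)) (hD : ∀ x ∈ D, x.1 ≠ x.2)
    (hσ : ∀ e : Edge n, 1 - dirCount D e * (p / 2) ≤ σ ^ dirCount D e) :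
    PrGnp n p (avoids D) ≤ σ ^ D.card := by
  classical
  let S : Edge n → Finset (Option Bool) := fun e => Finset.univ.filter fun c =>
    (e.1 ∈ D → c ≠ some true) ∧ (e.1.swap ∈ D → c ≠ some false)
  have hset : avoids D = (Fintype.piFinset S : Set (Config n)) := by
    ext f
    rw [mem_avoids D]
    simp [S]
  rw [PrGnp, hset, prWeight_finset, ← Finset.prod_univ_sum S (fun _ c => edgeWeight p c),
    ← sum_dirCount D hD, ← Finset.prod_pow_eq_pow_sum]
  refine Finset.prod_le_prod (fun e _ => Finset.sum_nonneg fun c _ => edgeWeight_nonneg h0 h1 c)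
    fun e _ => ?_
  refine le_trans (le_of_eq ?_) (hσ e)
  simp only [S, Finset.sum_filter, Fintype.sum_option, Fintype.sum_bool, dirCount]
  by_cases ha : e.1 ∈ D <;> by_cases hb : e.1.swap ∈ D <;> simp [ha, hb, edgeWeight] <;> ring

lemma prGnp_avoids_le_pow {n : ℕ} {p : ℝ} (h0 : 0 ≤ p) (h1 : p ≤ 1)
    (D : Finset (Fin n × Fin n)) (hD : ∀ x ∈ D, x.1 ≠ x.2) :
    PrGnp n p (avoids D) ≤ (1 - p / 2) ^ D.card := by
  refine prGnp_avoids_le h0 h1 D hD fun e => ?_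
  unfold dirCount
  split_ifs <;> norm_num; nlinarith [sq_nonneg p]

lemma prGnp_avoids_le_pow_of_symm {n : ℕ} {p : ℝ} (h0 : 0 ≤ p) (h1 : p ≤ 1) {k : ℕ}
    (D : Finset (Fin n × Fin n)) (hD : ∀ x ∈ D, x.1 ≠ x.2) (hsymm : ∀ x ∈ D, x.swap ∈ D)
    (hk : D.card = 2 * k) :
    PrGnp n p (avoids D) ≤ (1 - p) ^ k := by
  have := prGnp_avoids_le (σ := √(1 - p)) h0 h1 D hD fun e => ?_
  · rwa [hk, pow_mul, Real.sq_sqrt (by linarith)] at this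
  have h3 : e.1.swap ∈ D ↔ e.1 ∈ D := ⟨fun h => by simpa using hsymm _ h, hsymm _⟩
  unfold dirCount
  rw [if_congr h3 rfl rfl]
  split_ifs
  · norm_num [Real.sq_sqrt (show 0 ≤ 1 - p by linarith)]
    linarith
  · simp

/-- In `⃗G(n,m)`, avoiding a set of `ℓ` directed edges on distinct pairs has a probability
that depends on `ℓ` only. -/
lemma prGnm_avoids_eq {n m : ℕ} (D : Finset (Fin n × Fin n)) (hD : ∀ x ∈ D, x.1 ≠ x.2)
    (hD' : ∀ x ∈ D, x.swap ∉ D) (F : Finset (Edge n)) (o : Edge n → Bool)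
    (hF : F.card = D.card) :
    PrGnm n m (avoids D) = PrGnm n m {f | ∀ e ∈ F, f e ≠ some (o e)} := by
  classical
  let G : Finset (Edge n) := Finset.univ.filter fun e => e.1 ∈ D ∨ e.1.swap ∈ D
  have hG : G.card = D.card := by
    rw [← sum_dirCount D hD, Finset.card_filter]
    refine Finset.sum_congr rfl fun e _ => ?_
    unfold dirCount
    by_cases ha : e.1 ∈ D
    · simp [ha, hD' _ ha]
    · simp [ha]
  have hset : avoids D = {f | ∀ e ∈ G, f e ≠ some (decide (e.1 ∈ D))} := by
    ext f
    rw [mem_avoids D]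
    simp only [Set.mem_ofPred_eq, G, Finset.mem_filter, Finset.mem_univ, true_and]
    refine forall_congr' fun e => ?_
    by_cases ha : e.1 ∈ D
    · simp [ha, hD' _ ha]
    · simp [ha]
  rw [hset, prGnm_avoid, prGnm_avoid, hG, hF]

end Comparison

section Hypergeometric

lemma abs_prod_sub_prod_le {k : ℕ} {f g : ℕ → ℝ} (hf : ∀ j < k, |f j| ≤ 1)
    (hg : ∀ j < k, |g j| ≤ 1) :
    |∏ j ∈ Finset.range k, f j - ∏ j ∈ Finset.range k, g j| ≤
      ∑ j ∈ Finset.range k, |f j - g j| := by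
  induction k with
  | zero => simp
  | succ k ih =>
    have ih' := ih (fun j hj => hf j (by omega)) (fun j hj => hg j (by omega))
    have h1 : |∏ j ∈ Finset.range k, g j| ≤ 1 := by
      rw [Finset.abs_prod]
      exact Finset.prod_le_one (fun _ _ => abs_nonneg _)
        fun j hj => hg j (by have := Finset.mem_range.1 hj; omega)
    rw [Finset.prod_range_succ, Finset.prod_range_succ, Finset.sum_range_succ]
    calc _ = |(∏ j ∈ Finset.range k, f j - ∏ j ∈ Finset.range k, g j) * f k +
          (∏ j ∈ Finset.range k, g j) * (f k - g k)| := by ring_nf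
      _ ≤ |∏ j ∈ Finset.range k, f j - ∏ j ∈ Finset.range k, g j| * |f k| +
          |∏ j ∈ Finset.range k, g j| * |f k - g k| := by
        rw [← abs_mul, ← abs_mul]
        exact abs_add_le _ _
      _ ≤ _ := by
        gcongr
        · exact (mul_le_of_le_one_right (abs_nonneg _) (hf k (by omega))).trans ih'
        · exact mul_le_of_le_one_left (abs_nonneg _) h1

lemma exp_neg_le_one_sub_add_sq {u : ℝ} (hu : 0 ≤ u) : exp (-u) ≤ 1 - u + u ^ 2 := by
  rw [exp_neg, inv_le_iff_one_le_mul₀ (exp_pos u)]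
  have h := add_one_le_exp u
  nlinarith [pow_nonneg hu 3, mul_le_mul_of_nonneg_left h (show 0 ≤ 1 - u + u ^ 2 by nlinarith)]

/-- The probability that `k` given elements are missed by a uniform `m`-subset. -/
lemma choose_sub_eq_prod {M m k : ℕ} (hm : m ≤ M) (hk : k ≤ M) :
    ((M - k).choose m : ℝ) =
      M.choose m * ∏ j ∈ Finset.range k, (((M - m : ℕ) : ℝ) - j) / ((M : ℝ) - j) := by
  induction k with
  | zero => simp
  | succ k ih =>
    rw [Finset.prod_range_succ, ← mul_assoc, ← ih (by omega)]
    obtain ⟨d, hd⟩ : ∃ d, M - k = d + 1 := ⟨M - k - 1, by omega⟩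
    have hd' : M - (k + 1) = d := by omega
    have hMk : (M : ℝ) - k = d + 1 := by
      rw [← Nat.cast_sub (by omega), hd]
      push_cast
      ring
    rw [hd, hd', hMk, Nat.cast_sub hm]
    have h := Nat.choose_mul_succ_eq d m
    rw [← mul_div_assoc, eq_div_iff (by positivity)]
    rcases le_or_gt m (d + 1) with h1 | h1
    · have := congrArg (Nat.cast (R := ℝ)) h
      push_cast [Nat.cast_sub h1] at this
      rw [this]
      congr 1
      linarith
    · rw [Nat.choose_eq_zero_of_lt h1, Nat.choose_eq_zero_of_lt (show d < m by omega)]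
      simp

lemma abs_max_sub_exp_le {y M j : ℝ} (hy : 0 < y) (hy1 : y ≤ 1) (hM : 0 < M) (hj : 0 ≤ j)
    (hjM : 2 * j ≤ M) :
    |max 0 ((1 - j / (M * y)) / (1 - j / M)) - exp (-(j * ((1 - y) / (y * M))))| ≤
      3 * j ^ 2 / (y * M) ^ 2 := by
  set z := j / (y * M) with hz
  have hz0 : 0 ≤ z := by positivity
  set u := j * ((1 - y) / (y * M)) with hu
  have huz : u = z * (1 - y) := by rw [hu, hz]; ring
  have hu0 : 0 ≤ u := by rw [huz]; exact mul_nonneg hz0 (by linarith)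
  have huz' : u ≤ z := by rw [huz]; nlinarith
  have hx : j / M = z * y := by rw [hz]; field_simp
  have hx' : j / (M * y) = z := by rw [hz, mul_comm]
  have hx2 : z * y ≤ 1 / 2 := by
    rw [← hx, div_le_iff₀ hM]
    linarith
  rw [hx, hx']
  have hzsq : 3 * j ^ 2 / (y * M) ^ 2 = 3 * z ^ 2 := by rw [hz]; ring
  rw [hzsq]
  have hden : 0 < 1 - z * y := by linarith
  have ht1 : (1 - z) / (1 - z * y) ≤ 1 - u := by
    rw [div_le_iff₀ hden, huz]
    nlinarith [mul_nonneg (mul_nonneg hz0 hz0) (mul_nonneg hy.le (sub_nonneg.2 hy1))]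
  have ht2 : 1 - u - 2 * z ^ 2 ≤ (1 - z) / (1 - z * y) := by
    rw [le_div_iff₀ hden, huz]
    have h1 : z * (1 - y) * (z * y) ≤ z ^ 2 := by
      nlinarith [mul_nonneg hz0 hz0, mul_nonneg (mul_nonneg hz0 hz0) (sub_nonneg.2 hy1),
        mul_nonneg (mul_nonneg hz0 hz0) (sq_nonneg y),
        mul_nonneg (mul_nonneg hz0 hz0) (sq_nonneg (1 - y))]
    have h2 : z ^ 2 * 1 ≤ z ^ 2 * (2 * (1 - z * y)) := by
      gcongr
      linarith
    nlinarith
  have he1 : 1 - u ≤ exp (-u) := by linarith [add_one_le_exp (-u)]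
  have he2 := exp_neg_le_one_sub_add_sq hu0
  have husq : u ^ 2 ≤ z ^ 2 := by gcongr
  rw [abs_sub_comm, abs_of_nonneg (sub_nonneg.2 (max_le (exp_pos _).le (ht1.trans he1)))]
  have := le_max_right 0 ((1 - z) / (1 - z * y))
  linarith

lemma sum_range_cast (k : ℕ) : ∑ j ∈ Finset.range k, (j : ℝ) = k * (k - 1) / 2 := by
  induction k with
  | zero => simp
  | succ k ih => rw [Finset.sum_range_succ, ih]; push_cast; ring

lemma abs_prod_ratio_sub_exp_le {M Q k ℓ : ℕ} (hQ : 0 < Q) (hQM : Q ≤ M) (hk : k ≤ ℓ)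
    (hℓ : 2 * ℓ ≤ M) :
    |∏ j ∈ Finset.range k, ((1 - (j : ℝ) / (M * ((Q : ℝ) / M))) / (1 - (j : ℝ) / M)) -
        exp (-((k * (k - 1) / 2) * ((1 - (Q : ℝ) / M) / ((Q : ℝ) / M * M))))| ≤
      3 * ℓ * (k * (k - 1)) / ((Q : ℝ) / M * M) ^ 2 := by
  have hM : (0 : ℝ) < M := by exact_mod_cast hQ.trans_le hQM
  have hQ' : (0 : ℝ) < Q := by exact_mod_cast hQ
  have hQM' : (Q : ℝ) ≤ M := by exact_mod_cast hQM
  set y : ℝ := (Q : ℝ) / M with hy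
  have hy0 : 0 < y := by positivity
  have hy1 : y ≤ 1 := div_le_one_of_le₀ hQM' hM.le
  have hMy : M * y = Q := by rw [hy]; field_simp
  have hjM : ∀ j < k, (2 * (j : ℝ)) ≤ M := fun j hj => by
    exact_mod_cast (show 2 * j ≤ M by omega)
  have hden : ∀ j < k, 0 < 1 - (j : ℝ) / M := fun j hj => by
    have : (j : ℝ) / M ≤ 1 / 2 := by
      rw [div_le_iff₀ hM]
      linarith [hjM j hj]
    linarith
  have hclip : ∏ j ∈ Finset.range k, ((1 - (j : ℝ) / (M * y)) / (1 - (j : ℝ) / M)) =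
      ∏ j ∈ Finset.range k, max 0 ((1 - (j : ℝ) / (M * y)) / (1 - (j : ℝ) / M)) := by
    rcases lt_or_ge Q k with h | h
    · have hz : (1 - (Q : ℝ) / (M * y)) / (1 - (Q : ℝ) / M) = 0 := by
        rw [hMy, div_self hQ'.ne']
        simp
      rw [Finset.prod_eq_zero (Finset.mem_range.2 h) hz,
        Finset.prod_eq_zero (Finset.mem_range.2 h) (by rw [hz, max_self])]
    · refine Finset.prod_congr rfl fun j hj => ?_
      have hj := Finset.mem_range.1 hj
      rw [max_eq_right]
      refine div_nonneg ?_ (hden j hj).le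
      rw [hMy, sub_nonneg]
      exact div_le_one_of_le₀ (by exact_mod_cast (show j ≤ Q by omega)) hQ'.le
  have hexp : exp (-((k * (k - 1) / 2) * ((1 - y) / (y * M)))) =
      ∏ j ∈ Finset.range k, exp (-((j : ℝ) * ((1 - y) / (y * M)))) := by
    rw [← Real.exp_sum, Finset.sum_neg_distrib, ← Finset.sum_mul, sum_range_cast]
  rw [hclip, hexp]
  refine (abs_prod_sub_prod_le ?_ ?_).trans ?_
  · intro j hj
    rw [abs_of_nonneg (le_max_left _ _)]
    refine max_le zero_le_one (div_le_one_of_le₀ ?_ (hden j hj).le)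
    have : (j : ℝ) / M ≤ j / (M * y) := by
      gcongr
      exact mul_le_of_le_one_right hM.le hy1
    linarith
  · intro j hj
    rw [abs_of_pos (exp_pos _), exp_le_one_iff, neg_nonpos]
    have : 0 ≤ 1 - y := by linarith
    positivity
  · calc _ ≤ ∑ j ∈ Finset.range k, 3 * ℓ / (y * M) ^ 2 * (j : ℝ) := by
          refine Finset.sum_le_sum fun j hj => ?_
          have hj := Finset.mem_range.1 hj
          refine (abs_max_sub_exp_le hy0 hy1 hM (Nat.cast_nonneg j) (hjM j hj)).trans ?_
          rw [show 3 * ℓ / (y * M) ^ 2 * (j : ℝ) = 3 * ℓ * j / (y * M) ^ 2 by ring]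
          refine div_le_div_of_nonneg_right ?_ (sq_nonneg _)
          have : (j : ℝ) ≤ ℓ := by exact_mod_cast (show j ≤ ℓ by omega)
          nlinarith [Nat.cast_nonneg (α := ℝ) j]
      _ = 3 * ℓ * (k * (k - 1)) / (y * M) ^ 2 / 2 := by
          rw [← Finset.mul_sum, sum_range_cast]
          ring
      _ ≤ _ := by
          refine half_le_self (div_nonneg (mul_nonneg (by positivity) ?_) (by positivity))
          rcases Nat.eq_zero_or_pos k with rfl | h
          · simp
          · have : (1 : ℝ) ≤ k := by exact_mod_cast h
            nlinarith

lemma abs_exp_neg_sub_exp_neg_le {a b : ℝ} (ha : 0 ≤ a) (hb : 0 ≤ b) :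
    |exp (-a) - exp (-b)| ≤ |a - b| := by
  wlog h : a ≤ b generalizing a b
  · rw [abs_sub_comm, abs_sub_comm a b]
    exact this hb ha (le_of_not_ge h)
  have h1 : exp (-b) ≤ exp (-a) := by gcongr
  rw [abs_of_nonneg (by linarith), abs_sub_comm, abs_of_nonneg (by linarith)]
  have h2 : exp (-b) = exp (-a) * exp (-(b - a)) := by
    rw [← exp_add]
    ring_nf
  have h3 := add_one_le_exp (-(b - a))
  have h4 : exp (-a) ≤ 1 := by simpa using ha
  rw [h2]
  nlinarith [exp_pos (-a)]

/-- Weights of the binomial distribution with parameters `ℓ` and `θ`. -/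
lemma binomial_moments (ℓ : ℕ) (θ : ℝ) :
    ∑ k ∈ Finset.range (ℓ + 1), (ℓ.choose k : ℝ) * θ ^ k * (1 - θ) ^ (ℓ - k) = 1 ∧
    ∑ k ∈ Finset.range (ℓ + 1), (ℓ.choose k : ℝ) * θ ^ k * (1 - θ) ^ (ℓ - k) * k = ℓ * θ ∧
    ∑ k ∈ Finset.range (ℓ + 1), (ℓ.choose k : ℝ) * θ ^ k * (1 - θ) ^ (ℓ - k) * (k * (k - 1)) =
      ℓ * (ℓ - 1) * θ ^ 2 := by
  have h0 := congrArg (Polynomial.eval θ) (bernsteinPolynomial.sum ℝ ℓ)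
  have h1 := congrArg (Polynomial.eval θ) (bernsteinPolynomial.sum_smul ℝ ℓ)
  have h2 := congrArg (Polynomial.eval θ) (bernsteinPolynomial.sum_mul_smul ℝ ℓ)
  have hc : ∀ k : ℕ, ((k * (k - 1) : ℕ) : ℝ) = k * (k - 1) := by
    intro k
    cases k <;> simp
  simp only [bernsteinPolynomial, nsmul_eq_mul, Polynomial.eval_finsetSum, Polynomial.eval_mul,
    Polynomial.eval_pow, Polynomial.eval_X, Polynomial.eval_sub, Polynomial.eval_one,
    Polynomial.eval_natCast, hc] at h0 h1 h2
  refine ⟨h0, ?_, ?_⟩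
  · rw [← h1]
    exact Finset.sum_congr rfl fun k _ => mul_comm _ _
  · rw [← h2]
    exact Finset.sum_congr rfl fun k _ => mul_comm _ _

end Hypergeometric

section AvoidanceAsymptotics

lemma abs_mul_pred_sub_sq_le {ℓ k : ℕ} (hℓ : 0 < ℓ) {μ : ℝ} (hμ : 0 ≤ μ) :
    |(k : ℝ) * (k - 1) - μ ^ 2| ≤
      (k - μ) ^ 2 + μ * (√ℓ + (k - μ) ^ 2 / √ℓ) + k := by
  have hs : 0 < √(ℓ : ℝ) := Real.sqrt_pos.2 (by exact_mod_cast hℓ)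
  have h1 : 2 * |(k : ℝ) - μ| ≤ √ℓ + (k - μ) ^ 2 / √ℓ := by
    rw [← sub_nonneg]
    have : √ℓ + (k - μ) ^ 2 / √ℓ - 2 * |(k : ℝ) - μ| = (√ℓ - |(k : ℝ) - μ|) ^ 2 / √ℓ := by
      rw [← sq_abs ((k : ℝ) - μ)]
      field_simp
      ring
    rw [this]
    positivity
  have h2 : (k : ℝ) * (k - 1) - μ ^ 2 = (k - μ) ^ 2 + μ * (2 * (k - μ)) - k := by ring
  have hk : (0 : ℝ) ≤ k := Nat.cast_nonneg k
  calc _ = |(k - μ) ^ 2 + μ * (2 * (k - μ)) - k| := by rw [h2]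
    _ ≤ |(k - μ) ^ 2| + |μ * (2 * (k - μ))| + |(k : ℝ)| :=
        (abs_sub _ _).trans (by gcongr; exact abs_add_le _ _)
    _ = (k - μ) ^ 2 + μ * (2 * |k - μ|) + k := by
        rw [abs_of_nonneg (sq_nonneg _), abs_of_nonneg hk, abs_mul, abs_mul, abs_of_nonneg hμ,
          abs_two]
    _ ≤ _ := by gcongr

lemma abs_avoid_sum_sub_exp_le {M m ℓ : ℕ} (hM : 0 < M) (hm : m ≤ M) (hℓ : 0 < ℓ)
    (hℓM : 2 * ℓ ≤ M) :
    |(∑ k ∈ Finset.range (ℓ + 1), (ℓ.choose k : ℝ) * ((M - k).choose m : ℝ)) /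
        (2 ^ ℓ * (M.choose m : ℝ)) / (1 - (m : ℝ) / M / 2) ^ ℓ -
      exp (-(ℓ ^ 2 / (2 * M) * ((m : ℝ) / M * (1 - (m : ℝ) / M) / (2 - (m : ℝ) / M) ^ 2)))| ≤
      3 * ℓ ^ 3 / M ^ 2 + 2 * (ℓ * √ℓ) / M := by
  have hM' : (0 : ℝ) < M := by exact_mod_cast hM
  have hmM : (m : ℝ) ≤ M := by exact_mod_cast hm
  have hch : (0 : ℝ) < M.choose m := by exact_mod_cast Nat.choose_pos hm
  have hs : 0 < √(ℓ : ℝ) := Real.sqrt_pos.2 (by exact_mod_cast hℓ)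
  set Q := M - m with hQdef
  set y : ℝ := (Q : ℝ) / M with hy
  have hpy : (m : ℝ) / M = 1 - y := by
    rw [hy, hQdef, Nat.cast_sub hm]
    field_simp
    ring
  have hy0 : 0 ≤ y := by positivity
  have hy1 : y ≤ 1 := by
    have : 0 ≤ (m : ℝ) / M := by positivity
    linarith
  set θ : ℝ := y / (1 + y) with hθ
  have hθ0 : 0 ≤ θ := by positivity
  have hθy : θ ≤ y := div_le_self hy0 (by linarith)
  have hθ1 : 1 - θ = 1 / (1 + y) := by rw [hθ]; field_simp; ring
  have hr : 1 - (1 - y) / 2 = (1 + y) / 2 := by ring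
  set ρ : ℕ → ℝ := fun k => ∏ j ∈ Finset.range k, ((1 - (j : ℝ) / (M * y)) / (1 - (j : ℝ) / M))
    with hρ
  set w : ℕ → ℝ := fun k => (ℓ.choose k : ℝ) * θ ^ k * (1 - θ) ^ (ℓ - k) with hw
  have hw0 : ∀ k, 0 ≤ w k := fun k => by
    have : 0 ≤ 1 - θ := by rw [hθ1]; positivity
    positivity
  obtain ⟨e0, e1, e2⟩ := binomial_moments ℓ θ
  rw [hpy, hr]
  rcases Nat.eq_zero_or_pos Q with hQ | hQ
  · have hmM : m = M := by omega
    have hy00 : y = 0 := by rw [hy, hQ]; simp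
    have hsum : ∑ k ∈ Finset.range (ℓ + 1), (ℓ.choose k : ℝ) * ((M - k).choose m : ℝ) = 1 := by
      rw [Finset.sum_eq_single 0]
      · simp [hmM]
      · intro k hk hk0
        have := Finset.mem_range.1 hk
        rw [Nat.choose_eq_zero_of_lt (show M - k < m by omega)]
        simp
      · simp
    rw [hsum, hmM, Nat.choose_self, hy00]
    have : |(1 : ℝ) / (2 ^ ℓ * ((1 : ℕ) : ℝ)) / ((1 + 0) / 2) ^ ℓ -
      exp (-((ℓ : ℝ) ^ 2 / (2 * M) * ((1 - 0) * (1 - (1 - 0)) / (2 - (1 - 0)) ^ 2)))| = 0 := by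
      simp
    rw [this]
    positivity
  have hyp : 0 < y := by
    have : (0 : ℝ) < Q := by exact_mod_cast hQ
    positivity
  have hmain : (∑ k ∈ Finset.range (ℓ + 1), (ℓ.choose k : ℝ) * ((M - k).choose m : ℝ)) /
        (2 ^ ℓ * (M.choose m : ℝ)) / ((1 + y) / 2) ^ ℓ = ∑ k ∈ Finset.range (ℓ + 1), w k * ρ k := by
    rw [Finset.sum_div, Finset.sum_div]
    refine Finset.sum_congr rfl fun k hk => ?_
    have hk : k ≤ ℓ := by simpa [Nat.lt_succ_iff] using hk
    have hprod : ∏ j ∈ Finset.range k, ((Q : ℝ) - j) / ((M : ℝ) - j) = y ^ k * ρ k := by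
      rw [hρ, ← Finset.card_range k, ← Finset.prod_const, Finset.card_range,
        ← Finset.prod_mul_distrib]
      refine Finset.prod_congr rfl fun j hj => ?_
      have hj := Finset.mem_range.1 hj
      have hjM : (0 : ℝ) < M - j := by
        rw [sub_pos]
        exact_mod_cast (show j < M by omega)
      have h1 : (1 : ℝ) - j / M = (M - j) / M := by field_simp
      have h2 : (1 : ℝ) - j / (M * y) = (Q - j) / (M * y) := by
        have : M * y = Q := by rw [hy]; field_simp
        rw [this]
        have : (Q : ℝ) ≠ 0 := by exact_mod_cast hQ.ne'
        field_simp
      rw [h1, h2]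
      field_simp
    rw [choose_sub_eq_prod hm (by omega), hprod, hw]
    simp only
    rw [hθ1, hθ, div_pow y (1 + y), div_pow 1 (1 + y), div_pow (1 + y) 2, one_pow]
    have : (1 + y) ^ ℓ = (1 + y) ^ k * (1 + y) ^ (ℓ - k) := by
      rw [← pow_add, Nat.add_sub_cancel' hk]
    rw [this]
    field_simp
  set κ : ℝ := (1 - y) / (y * M) with hκ
  have hκ0 : 0 ≤ κ := div_nonneg (by linarith) (by positivity)
  set μ : ℝ := ℓ * θ with hμ
  have hμ0 : 0 ≤ μ := by positivity
  have hψ : (ℓ : ℝ) ^ 2 / (2 * M) * ((1 - y) * (1 - (1 - y)) / (2 - (1 - y)) ^ 2) =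
      μ ^ 2 / 2 * κ := by
    rw [hμ, hκ, hθ, show 2 - (1 - y) = 1 + y by ring]
    field_simp
    ring
  rw [hmain, hψ]
  have hpt : ∀ k ∈ Finset.range (ℓ + 1), |ρ k - exp (-(μ ^ 2 / 2 * κ))| ≤
      3 * ℓ / (y * M) ^ 2 * (k * (k - 1)) +
      κ / 2 * ((1 + μ / √ℓ) * (k * (k - 1) + k - 2 * μ * k + μ ^ 2) + μ * √ℓ + k) := by
    intro k hk
    have hk : k ≤ ℓ := by simpa [Nat.lt_succ_iff] using hk
    have h1 := abs_prod_ratio_sub_exp_le hQ (Nat.sub_le M m) hk hℓM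
    have hkk : (0 : ℝ) ≤ k * (k - 1) := by
      rcases Nat.eq_zero_or_pos k with rfl | h
      · simp
      · have : (1 : ℝ) ≤ k := by exact_mod_cast h
        nlinarith
    have h2 : |exp (-((k * (k - 1) / 2) * κ)) - exp (-(μ ^ 2 / 2 * κ))| ≤
        κ / 2 * ((k - μ) ^ 2 + μ * (√ℓ + (k - μ) ^ 2 / √ℓ) + k) := by
      refine (abs_exp_neg_sub_exp_neg_le (by positivity) (by positivity)).trans ?_
      rw [show (k * (k - 1) / 2 : ℝ) * κ - μ ^ 2 / 2 * κ = κ / 2 * (k * (k - 1) - μ ^ 2) by ring,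
        abs_mul, abs_of_nonneg (by positivity : 0 ≤ κ / 2)]
      gcongr
      exact abs_mul_pred_sub_sq_le hℓ hμ0
    refine (abs_sub_le _ (exp (-((k * (k - 1) / 2) * κ))) _).trans ((add_le_add h1 h2).trans_eq ?_)
    rw [← hy]
    ring
  calc |∑ k ∈ Finset.range (ℓ + 1), w k * ρ k - exp (-(μ ^ 2 / 2 * κ))|
      = |∑ k ∈ Finset.range (ℓ + 1), w k * (ρ k - exp (-(μ ^ 2 / 2 * κ)))| := by
        simp only [mul_sub]
        rw [Finset.sum_sub_distrib, ← Finset.sum_mul, e0, one_mul]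
    _ ≤ ∑ k ∈ Finset.range (ℓ + 1), w k * (3 * ℓ / (y * M) ^ 2 * (k * (k - 1)) +
          κ / 2 * ((1 + μ / √ℓ) * (k * (k - 1) + k - 2 * μ * k + μ ^ 2) + μ * √ℓ + k)) := by
        refine (Finset.abs_sum_le_sum_abs _ _).trans (Finset.sum_le_sum fun k hk => ?_)
        rw [abs_mul, abs_of_nonneg (hw0 k)]
        exact mul_le_mul_of_nonneg_left (hpt k hk) (hw0 k)
    _ = ∑ k ∈ Finset.range (ℓ + 1),
          ((3 * ℓ / (y * M) ^ 2 + κ / 2 * (1 + μ / √ℓ)) * (w k * (k * (k - 1))) +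
          κ / 2 * ((1 + μ / √ℓ) * (1 - 2 * μ) + 1) * (w k * k) +
          κ / 2 * ((1 + μ / √ℓ) * μ ^ 2 + μ * √ℓ) * w k) :=
        Finset.sum_congr rfl fun k _ => by ring
    _ = (3 * ℓ / (y * M) ^ 2 + κ / 2 * (1 + μ / √ℓ)) * (ℓ * (ℓ - 1) * θ ^ 2) +
          κ / 2 * ((1 + μ / √ℓ) * (1 - 2 * μ) + 1) * μ +
          κ / 2 * ((1 + μ / √ℓ) * μ ^ 2 + μ * √ℓ) * 1 := by
        rw [Finset.sum_add_distrib, Finset.sum_add_distrib, ← Finset.mul_sum, ← Finset.mul_sum,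
          ← Finset.mul_sum, e0, e1, e2]
    _ = 3 * ℓ / (y * M) ^ 2 * (ℓ * (ℓ - 1) * θ ^ 2) +
          κ / 2 * ((1 + μ / √ℓ) * (μ * (1 - θ)) + μ * √ℓ + μ) := by
        rw [hμ]
        ring
    _ ≤ _ := by
        have hℓ1 : (1 : ℝ) ≤ ℓ := by exact_mod_cast hℓ
        have hss : √(ℓ : ℝ) * √ℓ = ℓ := Real.mul_self_sqrt (by positivity)
        have hs1 : 1 ≤ √(ℓ : ℝ) := Real.one_le_sqrt.2 hℓ1
        gcongr ?_ + ?_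
        · calc 3 * (ℓ : ℝ) / (y * M) ^ 2 * (ℓ * (ℓ - 1) * θ ^ 2)
              ≤ 3 * (ℓ : ℝ) / (y * M) ^ 2 * (ℓ * ℓ * y ^ 2) := by
                gcongr
                linarith
            _ = 3 * (ℓ : ℝ) ^ 3 / M ^ 2 := by
                field_simp
        · have hμs : μ / √ℓ ≤ √ℓ := by
            rw [div_le_iff₀ hs, hss, hμ]
            exact mul_le_of_le_one_right (by positivity) (hθy.trans hy1)
          have h3 : μ * (1 - θ) ≤ μ := mul_le_of_le_one_right hμ0 (by linarith)
          have hκμ : κ * μ ≤ ℓ / M := by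
            calc κ * μ ≤ 1 / (y * M) * (ℓ * y) := by
                  rw [hκ, hμ]
                  gcongr
                  linarith
              _ = ℓ / M := by field_simp
          calc κ / 2 * ((1 + μ / √ℓ) * (μ * (1 - θ)) + μ * √ℓ + μ)
              ≤ κ / 2 * ((1 + √ℓ) * μ + μ * √ℓ + μ) := by
                have : 0 ≤ 1 - θ := by rw [hθ1]; positivity
                gcongr
            _ = κ * μ * (1 + √ℓ) := by ring
            _ ≤ ℓ / M * (√ℓ + √ℓ) := by gcongr
            _ = _ := by ring

end AvoidanceAsymptotics

section Cuts

/-- No pair `R u v` leaves the set `X`. -/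
def IsOutClosed {α : Type*} (R : α → α → Prop) (X : Finset α) : Prop :=
  ∀ u ∈ X, ∀ v ∉ X, ¬ R u v

lemma IsOutClosed.not_reflTransGen {α : Type*} {R : α → α → Prop} {X : Finset α}
    (h : IsOutClosed R X) {u v : α} (hu : u ∈ X) (hv : v ∉ X) : ¬ Relation.ReflTransGen R u v := by
  intro huv
  apply hv
  clear hv
  induction huv with
  | refl => exact hu
  | tail _ hR ih => exact by_contra fun hc => h _ ih _ hc hR

lemma exists_subset_pair {α : Type*} [DecidableEq α] {X : Finset α} {s : α} (hs : s ∈ X)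
    (hX : X.card ≤ 2) : ∃ u, X ⊆ {s, u} := by
  have : Nonempty α := ⟨s⟩
  have h : (X.erase s).card ≤ 1 := by
    rw [Finset.card_erase_of_mem hs]
    omega
  obtain ⟨u, hu⟩ := Finset.card_le_one_iff_subset_singleton.1 h
  refine ⟨u, fun x hx => ?_⟩
  by_cases hxs : x = s
  · simp [hxs]
  · have := hu (Finset.mem_erase.2 ⟨hxs, hx⟩)
    simp_all

variable {α : Type*} [Fintype α] [DecidableEq α] {R : α → α → Prop} {s a b : α}

lemma exists_small_cuts (hsa' : s ≠ a) (hsb : s ≠ b) (hcard : 7 ≤ Fintype.card α)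
    (hcut : ∀ X : Finset α, 3 ≤ X.card → X.card + 3 ≤ Fintype.card α → ¬ IsOutClosed R X)
    (h2 : ∀ u w, ∃ v ∉ ({s, u, w} : Finset α), R s v ∨ R v s)
    (h3 : ∀ v w, v ≠ a → ∃ u ∉ ({a, b, v, w} : Finset α), R u a ∨ R u v ∨ R b u)
    (h4 : ∀ v w, v ≠ b → ∃ u ∉ ({a, b, v, w} : Finset α), R u a ∨ R b u ∨ R v u)
    (hsa : ¬ Relation.ReflTransGen R s a) (hbs : ¬ Relation.ReflTransGen R b s) :
    ((∀ u, u ≠ b → ¬ R b u) ∧ (∀ u, u ≠ a → ¬ R u a)) ∨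
    ((∀ u, u ≠ b → ¬ R b u) ∧ (∀ u, u ≠ s → u ≠ b → ¬ R s u)) ∨
    ((∀ u, u ≠ a → ¬ R u a) ∧ (∀ u, u ≠ s → u ≠ a → ¬ R u s)) := by
  classical
  have hsmall : ∀ X : Finset α, IsOutClosed R X → X.card ≤ 2 ∨ Xᶜ.card ≤ 2 := by
    intro X hX
    rw [Finset.card_compl]
    by_contra! h
    exact hcut X (by omega) (by omega) hX
  obtain ⟨X, hX, hsX, haX⟩ : ∃ X : Finset α, IsOutClosed R X ∧ s ∈ X ∧ a ∉ X := by
    refine ⟨Finset.univ.filter fun v => Relation.ReflTransGen R s v, ?_, ?_, ?_⟩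
    · intro u hu v hv huv
      simp only [Finset.mem_filter, Finset.mem_univ, true_and] at hu hv
      exact hv (hu.tail huv)
    · simpa using Relation.ReflTransGen.refl
    · simpa using hsa
  obtain ⟨Z, hZ, hbZ, hsZ⟩ : ∃ Z : Finset α, IsOutClosed R Z ∧ b ∈ Z ∧ s ∉ Z := by
    refine ⟨Finset.univ.filter fun v => ¬ Relation.ReflTransGen R v s, ?_, ?_, ?_⟩
    · intro u hu v hv huv
      simp only [Finset.mem_filter, Finset.mem_univ, true_and, not_not] at hu hv
      exact hu (Relation.ReflTransGen.head huv hv)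
    · simpa using hbs
    · simpa using Relation.ReflTransGen.refl
  have hXc : X.card + Xᶜ.card = Fintype.card α := Finset.card_add_card_compl X
  have hZc : Z.card + Zᶜ.card = Fintype.card α := Finset.card_add_card_compl Z
  rcases hsmall X hX with hXs | hXs <;> rcases hsmall Z hZ with hZs | hZs
  · have hV : IsOutClosed R (X ∪ Z) := by
      intro u hu v hv
      rw [Finset.mem_union, not_or] at hv
      rcases Finset.mem_union.1 hu with h | h
      exacts [hX u h v hv.1, hZ u h v hv.2]
    have hVc : (X ∪ Z).card + (X ∪ Z)ᶜ.card = Fintype.card α := Finset.card_add_card_compl _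
    have hVu := Finset.card_union_le X Z
    have hV2 : (X ∪ Z).card ≤ 2 := by
      rcases hsmall _ hV with h | h <;> omega
    have hVeq : {s, b} = X ∪ Z := by
      refine Finset.eq_of_subset_of_card_le ?_ (by rwa [Finset.card_pair hsb])
      intro x hx
      rcases Finset.mem_insert.1 hx with rfl | hx
      · simp [hsX]
      · rw [Finset.mem_singleton.1 hx]
        simp [hbZ]
    refine Or.inr (Or.inl ⟨fun u hu huv => ?_, fun u hus hub huv => ?_⟩)
    · by_cases huZ : u ∈ Z
      · have : u ∈ ({s, b} : Finset α) := hVeq ▸ Finset.mem_union_right _ huZ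
        simp only [Finset.mem_insert, Finset.mem_singleton, hu, or_false] at this
        exact hsZ (this ▸ huZ)
      · exact hZ b hbZ u huZ huv
    · refine hV s (Finset.mem_union_left _ hsX) u ?_ huv
      rw [← hVeq]
      simp [hus, hub]
  · exfalso
    obtain ⟨u, hu⟩ := exists_subset_pair hsX hXs
    obtain ⟨w, hw⟩ := exists_subset_pair (Finset.mem_compl.2 hsZ) hZs
    obtain ⟨v, hv, h | h⟩ := h2 u w <;> simp only [Finset.mem_insert, Finset.mem_singleton,
      not_or] at hv
    · refine hX s hsX v (fun hvX => ?_) h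
      have := hu hvX
      simp_all
    · refine hZ v (by_contra fun hvZ => ?_) s hsZ h
      have := hw (Finset.mem_compl.2 hvZ)
      simp_all
  · obtain ⟨w, hw⟩ := exists_subset_pair (Finset.mem_compl.2 haX) hXs
    obtain ⟨v, hv⟩ := exists_subset_pair hbZ hZs
    by_cases hW : ∃ v ∈ Xᶜ, v ≠ a
    · exfalso
      obtain ⟨v', hv'X, hv'a⟩ := hW
      have hv'w : v' = w := by
        have := hw hv'X
        simpa [hv'a] using this
      subst hv'w
      obtain ⟨u, hu, h⟩ := h3 v' v hv'a
      simp only [Finset.mem_insert, Finset.mem_singleton, not_or] at hu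
      have huX : u ∈ X := by
        by_contra hc
        have := hw (Finset.mem_compl.2 hc)
        simp_all
      have huZ : u ∉ Z := fun hc => by
        have := hv hc
        simp_all
      rcases h with h | h | h
      exacts [hX u huX a haX h, hX u huX v' (Finset.mem_compl.1 hv'X) h, hZ b hbZ u huZ h]
    by_cases hZ' : ∃ v ∈ Z, v ≠ b
    · exfalso
      obtain ⟨v', hv'Z, hv'b⟩ := hZ'
      have hv'v : v' = v := by
        have := hv hv'Z
        simpa [hv'b] using this
      subst hv'v
      obtain ⟨u, hu, h⟩ := h4 v' w hv'b
      simp only [Finset.mem_insert, Finset.mem_singleton, not_or] at hu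
      have huX : u ∈ X := by
        by_contra hc
        have := hw (Finset.mem_compl.2 hc)
        simp_all
      have huZ : u ∉ Z := fun hc => by
        have := hv hc
        simp_all
      rcases h with h | h | h
      exacts [hX u huX a haX h, hZ b hbZ u huZ h, hZ v' hv'Z u huZ h]
    push Not at hW hZ'
    refine Or.inl ⟨fun u hu => hZ b hbZ u fun hc => hu (hZ' u hc), fun u hu => ?_⟩
    exact hX u (by_contra fun hc => hu (hW u (Finset.mem_compl.2 hc))) a haX
  · have hV : IsOutClosed R (X ∩ Z) := by
      intro u hu v hv
      rw [Finset.mem_inter] at hu hv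
      by_cases h : v ∈ X
      exacts [hZ u hu.2 v fun hc => hv ⟨h, hc⟩, hX u hu.1 v h]
    have hVc : (X ∩ Z).card + (X ∩ Z)ᶜ.card = Fintype.card α := Finset.card_add_card_compl _
    have hVu : (X ∩ Z)ᶜ.card ≤ Xᶜ.card + Zᶜ.card := by
      rw [Finset.compl_inter]
      exact Finset.card_union_le _ _
    have hV2 : (X ∩ Z)ᶜ.card ≤ 2 := by
      rcases hsmall _ hV with h | h <;> omega
    have hVeq : {s, a} = (X ∩ Z)ᶜ := by
      refine Finset.eq_of_subset_of_card_le ?_ (by rwa [Finset.card_pair hsa'])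
      intro x hx
      rcases Finset.mem_insert.1 hx with rfl | hx
      · simp [hsZ]
      · rw [Finset.mem_singleton.1 hx]
        simp [haX]
    refine Or.inr (Or.inr ⟨fun u hu huv => ?_, fun u hus hua huv => ?_⟩)
    · by_cases huX : u ∈ X
      · exact hX u huX a haX huv
      · have : u ∈ ({s, a} : Finset α) := by
          rw [hVeq]
          simp [huX]
        simp only [Finset.mem_insert, Finset.mem_singleton, hu, or_false] at this
        exact huX (this ▸ hsX)
    · have : u ∉ (X ∩ Z)ᶜ := by
        rw [← hVeq]
        simp [hus, hua]
      rw [Finset.mem_compl, not_not, Finset.mem_inter] at this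
      exact hZ u this.2 s hsZ huv

lemma not_reach_of_small_cut (hsa : s ≠ a) (hsb : s ≠ b) (hab : a ≠ b)
    (h : ((∀ u, u ≠ b → ¬ R b u) ∧ (∀ u, u ≠ a → ¬ R u a)) ∨
    ((∀ u, u ≠ b → ¬ R b u) ∧ (∀ u, u ≠ s → u ≠ b → ¬ R s u)) ∨
    ((∀ u, u ≠ a → ¬ R u a) ∧ (∀ u, u ≠ s → u ≠ a → ¬ R u s))) :
    ¬ Relation.ReflTransGen R s a ∧ ¬ Relation.ReflTransGen R b s := by
  have hb : (∀ u, u ≠ b → ¬ R b u) → ¬ Relation.ReflTransGen R b s := by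
    intro hb
    refine IsOutClosed.not_reflTransGen (X := {b}) ?_ (by simp) (by simpa using hsb)
    intro u hu v hv
    rw [Finset.mem_singleton] at hu hv
    rw [hu]
    exact hb v hv
  have ha : (∀ u, u ≠ a → ¬ R u a) → ¬ Relation.ReflTransGen R s a := by
    intro ha
    refine IsOutClosed.not_reflTransGen (X := {a}ᶜ) ?_ (by simpa using hsa) (by simp)
    intro u hu v hv
    simp only [Finset.mem_compl, Finset.mem_singleton, not_not] at hu hv
    rw [hv]
    exact ha u hu
  rcases h with ⟨h1, h2⟩ | ⟨h1, h2⟩ | ⟨h1, h2⟩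
  · exact ⟨ha h2, hb h1⟩
  · refine ⟨?_, hb h1⟩
    refine IsOutClosed.not_reflTransGen (X := {s, b}) ?_ (by simp) (by simp [hsa.symm, hab])
    intro u hu v hv
    simp only [Finset.mem_insert, Finset.mem_singleton, not_or] at hu hv
    rcases hu with rfl | rfl
    exacts [h2 v hv.1 hv.2, h1 v hv.2]
  · refine ⟨ha h1, ?_⟩
    refine IsOutClosed.not_reflTransGen (X := {s, a}ᶜ) ?_ (by simp [hsb.symm, hab.symm]) (by simp)
    intro u hu v hv
    simp only [Finset.mem_compl, Finset.mem_insert, Finset.mem_singleton, not_or, not_not,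
      not_and_or] at hu hv
    by_cases hvs : v = s
    · rw [hvs]
      exact h2 u hu.1 hu.2
    · rw [hv.resolve_left hvs]
      exact h1 u hu.2

end Cuts

section FiniteBound

/-- All pairs from `T` to `U` and from `V` to `T`. -/
def starPairs {α : Type*} [DecidableEq α] (T U V : Finset α) : Finset (α × α) :=
  T ×ˢ U ∪ V ×ˢ T

lemma mem_starPairs {α : Type*} [DecidableEq α] {T U V : Finset α} {x : α × α} :
    x ∈ starPairs T U V ↔ (x.1 ∈ T ∧ x.2 ∈ U) ∨ (x.1 ∈ V ∧ x.2 ∈ T) := by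
  simp [starPairs, Finset.mem_product]

lemma card_starPairs {α : Type*} [DecidableEq α] {T U V : Finset α} (hV : Disjoint T V) :
    (starPairs T U V).card = T.card * (U.card + V.card) := by
  rw [starPairs, Finset.card_union_of_disjoint, Finset.card_product, Finset.card_product]
  · ring
  · rw [Finset.disjoint_product]
    exact Or.inl hV

lemma fst_ne_snd_of_mem_starPairs {α : Type*} [DecidableEq α] {T U V : Finset α}
    (hU : Disjoint T U) (hV : Disjoint T V) : ∀ x ∈ starPairs T U V, x.1 ≠ x.2 := by
  intro x hx h
  rcases mem_starPairs.1 hx with ⟨h1, h2⟩ | ⟨h1, h2⟩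
  · exact Finset.disjoint_left.1 hU h1 (h ▸ h2)
  · exact Finset.disjoint_left.1 hV (h ▸ h2) h1

variable {n : ℕ}

lemma prGnp_star_le {p : ℝ} (h0 : 0 ≤ p) (h1 : p ≤ 1) {T U V : Finset (Fin n)}
    (hU : Disjoint T U) (hV : Disjoint T V) (hUV : U.card + V.card = 3) (hT : n - 4 ≤ T.card) :
    PrGnp n p (avoids (starPairs T U V)) ≤ (1 - p / 2) ^ (3 * (n - 4)) := by
  refine (prGnp_avoids_le_pow h0 h1 _ (fst_ne_snd_of_mem_starPairs hU hV)).trans ?_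
  rw [card_starPairs hV, hUV]
  exact pow_le_pow_of_le_one (by linarith) (by linarith) (by omega)

lemma prGnp_isolated_le {p : ℝ} (h0 : 0 ≤ p) (h1 : p ≤ 1) {T : Finset (Fin n)} {s : Fin n}
    (hs : s ∉ T) (hT : n - 3 ≤ T.card) :
    PrGnp n p (avoids (starPairs T {s} {s})) ≤ (1 - p) ^ (n - 3) := by
  have hd : Disjoint T {s} := Finset.disjoint_singleton_right.2 hs
  refine (prGnp_avoids_le_pow_of_symm (k := T.card) h0 h1 _ (fst_ne_snd_of_mem_starPairs hd hd)
    (fun x hx => ?_) (by rw [card_starPairs hd]; simp; ring)).trans ?_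
  · rw [mem_starPairs] at hx ⊢
    simp only [Prod.fst_swap, Prod.snd_swap]
    tauto
  · exact pow_le_pow_of_le_one (by linarith) (by linarith) hT

lemma prGnp_outClosed_le {p : ℝ} (h0 : 0 ≤ p) (h1 : p ≤ 1) (X : Finset (Fin n)) :
    PrGnp n p (avoids (X ×ˢ Xᶜ)) ≤ (1 - p / 2) ^ (X.card * (n - X.card)) := by
  refine (prGnp_avoids_le_pow h0 h1 _ fun x hx h => ?_).trans ?_
  · rw [Finset.mem_product, Finset.mem_compl] at hx
    exact hx.2 (h ▸ hx.1)
  · rw [Finset.card_product, Finset.card_compl, Fintype.card_fin]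

/-- The configurations excluded when classifying the cuts responsible for `s ↛ a` and `b ↛ s`. -/
def exceptional (s a b : Fin n) : Set (Config n) :=
  ({f | ∃ X ∈ Finset.univ.filter (fun X : Finset (Fin n) => 3 ≤ X.card ∧ X.card + 3 ≤ n),
      f ∈ avoids (X ×ˢ Xᶜ)} ∪
    {f | ∃ q ∈ (Finset.univ : Finset (Fin n × Fin n)),
      f ∈ avoids (starPairs {s, q.1, q.2}ᶜ {s} {s})}) ∪
  ({f | ∃ q ∈ Finset.univ.filter (fun q : Fin n × Fin n => q.1 ≠ a),
      f ∈ avoids (starPairs {a, b, q.1, q.2}ᶜ {a, q.1} {b})} ∪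
    {f | ∃ q ∈ Finset.univ.filter (fun q : Fin n × Fin n => q.1 ≠ b),
      f ∈ avoids (starPairs {a, b, q.1, q.2}ᶜ {a} {b, q.1})})

lemma prGnp_exceptional_le {p : ℝ} (h0 : 0 ≤ p) (h1 : p ≤ 1) (s a b : Fin n) :
    PrGnp n p (exceptional s a b) ≤
      ∑ k ∈ (Finset.range (n + 1)).filter (fun k => 3 ≤ k ∧ k + 3 ≤ n),
        (n.choose k : ℝ) * (1 - p / 2) ^ (k * (n - k)) +
      n ^ 2 * (1 - p) ^ (n - 3) + 2 * (n ^ 2 * (1 - p / 2) ^ (3 * (n - 4))) := by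
  have hw := gnp_weight_nonneg (n := n) h0 h1
  have hr : 0 ≤ 1 - p / 2 := by linarith
  have hq : 0 ≤ 1 - p := by linarith
  have hpairs : ((Finset.univ : Finset (Fin n × Fin n)).card : ℝ) = n ^ 2 := by
    simp [sq]
  have hpairs' : ∀ P : Fin n × Fin n → Prop, [DecidablePred P] →
      ((Finset.univ.filter P).card : ℝ) ≤ n ^ 2 := fun P _ => by
    rw [← hpairs]
    exact_mod_cast Finset.card_filter_le _ _
  have hb1 : ∑ X ∈ Finset.univ.filter (fun X : Finset (Fin n) => 3 ≤ X.card ∧ X.card + 3 ≤ n),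
      PrGnp n p (avoids (X ×ˢ Xᶜ)) ≤
      ∑ k ∈ (Finset.range (n + 1)).filter (fun k => 3 ≤ k ∧ k + 3 ≤ n),
        (n.choose k : ℝ) * (1 - p / 2) ^ (k * (n - k)) := by
    refine (Finset.sum_le_sum fun X _ => prGnp_outClosed_le h0 h1 X).trans_eq ?_
    have := Finset.sum_powerset_apply_card (x := (Finset.univ : Finset (Fin n)))
      (fun k => if 3 ≤ k ∧ k + 3 ≤ n then (1 - p / 2) ^ (k * (n - k)) else 0)
    rw [Finset.powerset_univ] at this
    rw [Finset.sum_filter, this, Finset.sum_filter, Finset.card_univ, Fintype.card_fin]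
    refine Finset.sum_congr rfl fun k _ => ?_
    split_ifs <;> simp
  have hb2 : ∑ q ∈ (Finset.univ : Finset (Fin n × Fin n)),
      PrGnp n p (avoids (starPairs {s, q.1, q.2}ᶜ {s} {s})) ≤ n ^ 2 * (1 - p) ^ (n - 3) := by
    rw [← hpairs, ← nsmul_eq_mul]
    refine Finset.sum_le_card_nsmul _ _ _ fun q _ => prGnp_isolated_le h0 h1 (by simp) ?_
    rw [Finset.card_compl, Fintype.card_fin]
    have := Finset.card_le_three (a := s) (b := q.1) (c := q.2)
    omega
  have hT : ∀ v w : Fin n, n - 4 ≤ (({a, b, v, w} : Finset (Fin n))ᶜ).card := by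
    intro v w
    rw [Finset.card_compl, Fintype.card_fin]
    have := Finset.card_le_four (a := a) (b := b) (c := v) (d := w)
    omega
  have hb3 : ∑ q ∈ Finset.univ.filter (fun q : Fin n × Fin n => q.1 ≠ a),
      PrGnp n p (avoids (starPairs {a, b, q.1, q.2}ᶜ {a, q.1} {b})) ≤
      n ^ 2 * (1 - p / 2) ^ (3 * (n - 4)) := by
    refine (Finset.sum_le_card_nsmul _ _ ((1 - p / 2) ^ (3 * (n - 4))) fun q hq =>
      prGnp_star_le h0 h1 ?_ ?_ ?_ (hT _ _)).trans ?_
    · simp [Finset.disjoint_right]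
    · simp [Finset.disjoint_right]
    · rw [Finset.card_pair (Finset.mem_filter.1 hq).2.symm, Finset.card_singleton]
    · rw [nsmul_eq_mul]
      exact mul_le_mul_of_nonneg_right (hpairs' _) (by positivity)
  have hb4 : ∑ q ∈ Finset.univ.filter (fun q : Fin n × Fin n => q.1 ≠ b),
      PrGnp n p (avoids (starPairs {a, b, q.1, q.2}ᶜ {a} {b, q.1})) ≤
      n ^ 2 * (1 - p / 2) ^ (3 * (n - 4)) := by
    refine (Finset.sum_le_card_nsmul _ _ ((1 - p / 2) ^ (3 * (n - 4))) fun q hq =>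
      prGnp_star_le h0 h1 ?_ ?_ ?_ (hT _ _)).trans ?_
    · simp [Finset.disjoint_right]
    · simp [Finset.disjoint_right]
    · rw [Finset.card_pair (Finset.mem_filter.1 hq).2.symm, Finset.card_singleton]
    · rw [nsmul_eq_mul]
      exact mul_le_mul_of_nonneg_right (hpairs' _) (by positivity)
  unfold exceptional
  refine (prWeight_union_le hw _ _).trans ((add_le_add ((prWeight_union_le hw _ _).trans
    (add_le_add ((prWeight_iUnion_le hw _ _).trans hb1) ((prWeight_iUnion_le hw _ _).trans hb2)))
    ((prWeight_union_le hw _ _).trans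
    (add_le_add ((prWeight_iUnion_le hw _ _).trans hb3)
      ((prWeight_iUnion_le hw _ _).trans hb4)))).trans_eq ?_)
  ring

lemma abs_prWeight_sub_three_le {α : Type*} [Fintype α] {w : α → ℝ} (hw : ∀ x, 0 ≤ w x)
    {E E₁ E₂ E₃ B : Set α} (hE : ∀ x ∉ B, x ∈ E ↔ x ∈ E₁ ∨ x ∈ E₂ ∨ x ∈ E₃)
    (h12 : ∀ x ∉ B, x ∈ E₁ → x ∉ E₂) (h13 : ∀ x ∉ B, x ∈ E₁ → x ∉ E₃)
    (h23 : ∀ x ∉ B, x ∈ E₂ → x ∉ E₃) :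
    |prWeight w E - (prWeight w E₁ + prWeight w E₂ + prWeight w E₃)| ≤ 3 * prWeight w B := by
  unfold prWeight
  rw [← Finset.sum_add_distrib, ← Finset.sum_add_distrib, ← Finset.sum_sub_distrib, Finset.mul_sum]
  refine (Finset.abs_sum_le_sum_abs _ _).trans (Finset.sum_le_sum fun x _ => ?_)
  have hb : ∀ G : Set α, 0 ≤ G.indicator w x ∧ G.indicator w x ≤ w x := fun G =>
    ⟨Set.indicator_nonneg (fun y _ => hw y) x, Set.indicator_le_self' (fun y _ => hw y) x⟩
  by_cases hx : x ∈ B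
  · rw [Set.indicator_of_mem hx, abs_le]
    have h0 := hb E
    have h1 := hb E₁
    have h2 := hb E₂
    have h3 := hb E₃
    have := hw x
    constructor <;> linarith
  · rw [Set.indicator_of_notMem hx]
    have h1 := h12 x hx
    have h2 := h13 x hx
    have h3 := h23 x hx
    have h4 := hE x hx
    by_cases g1 : x ∈ E₁ <;> by_cases g2 : x ∈ E₂ <;> by_cases g3 : x ∈ E₃ <;>
      simp_all

/-- The event `s ↛ a, b ↛ s` is, up to exceptional configurations, the disjoint union of three
events, each avoiding `2n - 3` directed edges. -/
lemma abs_prGnm_sub_three_le {m : ℕ} (hn : 7 ≤ n) {s a b : Fin n} (hsa : s ≠ a)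
    (hsb : s ≠ b) (hab : a ≠ b) (F : Finset (Edge n)) (hF : F.card = 2 * n - 3)
    (o : Edge n → Bool) :
    |PrGnm n m {f | ¬ Reaches f s a ∧ ¬ Reaches f b s} -
        3 * PrGnm n m {f | ∀ e ∈ F, f e ≠ some (o e)}| ≤ 3 * PrGnm n m (exceptional s a b) := by
  let D₁ : Finset (Fin n × Fin n) :=
    {b} ×ˢ Finset.univ.erase b ∪ ((Finset.univ.erase a).erase b) ×ˢ {a}
  let D₂ : Finset (Fin n × Fin n) :=
    {b} ×ˢ Finset.univ.erase b ∪ {s} ×ˢ ((Finset.univ.erase s).erase b)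
  let D₃ : Finset (Fin n × Fin n) :=
    Finset.univ.erase a ×ˢ {a} ∪ ((Finset.univ.erase s).erase a) ×ˢ {s}
  have hc1 : ∀ x : Fin n, (Finset.univ.erase x).card = n - 1 := fun x => by simp
  have hc2 : ∀ x y : Fin n, y ≠ x → ((Finset.univ.erase x).erase y).card = n - 2 := fun x y h => by
    rw [Finset.card_erase_of_mem (by simpa using h), hc1]
    omega
  have m1 : ∀ u v, (u, v) ∈ D₁ ↔ (u = b ∧ v ≠ b) ∨ ((u ≠ b ∧ u ≠ a) ∧ v = a) := by
    intro u v
    simp only [D₁, Finset.mem_union, Finset.mem_product, Finset.mem_singleton, Finset.mem_erase,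
      Finset.mem_univ, and_true]
  have m2 : ∀ u v, (u, v) ∈ D₂ ↔ (u = b ∧ v ≠ b) ∨ (u = s ∧ v ≠ b ∧ v ≠ s) := by
    intro u v
    simp only [D₂, Finset.mem_union, Finset.mem_product, Finset.mem_singleton, Finset.mem_erase,
      Finset.mem_univ, and_true]
  have m3 : ∀ u v, (u, v) ∈ D₃ ↔ (u ≠ a ∧ v = a) ∨ ((u ≠ a ∧ u ≠ s) ∧ v = s) := by
    intro u v
    simp only [D₃, Finset.mem_union, Finset.mem_product, Finset.mem_singleton, Finset.mem_erase,
      Finset.mem_univ, and_true]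
  have e1 : PrGnm n m (avoids D₁) = PrGnm n m {f | ∀ e ∈ F, f e ≠ some (o e)} := by
    refine prGnm_avoids_eq D₁ ?_ ?_ F o ?_
    · rintro ⟨u, v⟩ h
      rw [m1] at h
      intro huv
      dsimp only at huv
      grind
    · rintro ⟨u, v⟩ h h'
      rw [Prod.swap_prod_mk, m1] at h'
      rw [m1] at h
      grind
    · rw [hF, Finset.card_union_of_disjoint, Finset.card_product, Finset.card_product, hc1,
        hc2 _ _ hab.symm, Finset.card_singleton, Finset.card_singleton]
      · omega
      · rw [Finset.disjoint_product]
        exact Or.inl (by simp)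
  have e2 : PrGnm n m (avoids D₂) = PrGnm n m {f | ∀ e ∈ F, f e ≠ some (o e)} := by
    refine prGnm_avoids_eq D₂ ?_ ?_ F o ?_
    · rintro ⟨u, v⟩ h
      rw [m2] at h
      intro huv
      dsimp only at huv
      grind
    · rintro ⟨u, v⟩ h h'
      rw [Prod.swap_prod_mk, m2] at h'
      rw [m2] at h
      grind
    · rw [hF, Finset.card_union_of_disjoint, Finset.card_product, Finset.card_product, hc1,
        hc2 _ _ hsb.symm, Finset.card_singleton, Finset.card_singleton]
      · omega
      · rw [Finset.disjoint_product]
        exact Or.inl (by simpa using hsb.symm)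
  have e3 : PrGnm n m (avoids D₃) = PrGnm n m {f | ∀ e ∈ F, f e ≠ some (o e)} := by
    refine prGnm_avoids_eq D₃ ?_ ?_ F o ?_
    · rintro ⟨u, v⟩ h
      rw [m3] at h
      intro huv
      dsimp only at huv
      grind
    · rintro ⟨u, v⟩ h h'
      rw [Prod.swap_prod_mk, m3] at h'
      rw [m3] at h
      grind
    · rw [hF, Finset.card_union_of_disjoint, Finset.card_product, Finset.card_product, hc1,
        hc2 _ _ hsa.symm, Finset.card_singleton, Finset.card_singleton]
      · omega
      · rw [Finset.disjoint_product]
        exact Or.inr (by simpa using hsa.symm)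
  have a1 : ∀ f, f ∈ avoids D₁ ↔
      (∀ u, u ≠ b → ¬ DirEdge f b u) ∧ (∀ u, u ≠ a → ¬ DirEdge f u a) := by
    intro f
    simp only [avoids, Set.mem_ofPred_eq, Prod.forall, m1]
    constructor
    · refine fun h => ⟨fun u hu => h b u (Or.inl ⟨rfl, hu⟩), fun u hu => ?_⟩
      by_cases hub : u = b
      · exact h u a (Or.inl ⟨hub, hab⟩)
      · exact h u a (Or.inr ⟨⟨hub, hu⟩, rfl⟩)
    · rintro ⟨h1, h2⟩ u v (⟨rfl, hv⟩ | ⟨⟨-, hu⟩, rfl⟩)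
      exacts [h1 v hv, h2 u hu]
  have a2 : ∀ f, f ∈ avoids D₂ ↔
      (∀ u, u ≠ b → ¬ DirEdge f b u) ∧ (∀ u, u ≠ s → u ≠ b → ¬ DirEdge f s u) := by
    intro f
    simp only [avoids, Set.mem_ofPred_eq, Prod.forall, m2]
    constructor
    · exact fun h => ⟨fun u hu => h b u (Or.inl ⟨rfl, hu⟩),
        fun u hu hub => h s u (Or.inr ⟨rfl, hub, hu⟩)⟩
    · rintro ⟨h1, h2⟩ u v (⟨rfl, hv⟩ | ⟨rfl, hv, hv'⟩)
      exacts [h1 v hv, h2 v hv' hv]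
  have a3 : ∀ f, f ∈ avoids D₃ ↔
      (∀ u, u ≠ a → ¬ DirEdge f u a) ∧ (∀ u, u ≠ s → u ≠ a → ¬ DirEdge f u s) := by
    intro f
    simp only [avoids, Set.mem_ofPred_eq, Prod.forall, m3]
    constructor
    · exact fun h => ⟨fun u hu => h u a (Or.inl ⟨hu, rfl⟩),
        fun u hu hua => h u s (Or.inr ⟨⟨hua, hu⟩, rfl⟩)⟩
    · rintro ⟨h1, h2⟩ u v (⟨hu, rfl⟩ | ⟨⟨hu, hu'⟩, rfl⟩)
      exacts [h1 u hu, h2 u hu' hu]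
  have hcut : ∀ f ∉ exceptional s a b, ∀ X : Finset (Fin n), 3 ≤ X.card →
      X.card + 3 ≤ Fintype.card (Fin n) → ¬ IsOutClosed (DirEdge f) X := by
    intro f hf X h3 h4 hX
    rw [Fintype.card_fin] at h4
    refine hf (Or.inl (Or.inl ⟨X, by simp [h3, h4], ?_⟩))
    intro x hx
    rw [Finset.mem_product, Finset.mem_compl] at hx
    exact hX _ hx.1 _ hx.2
  have hiso : ∀ f ∉ exceptional s a b, ∀ u w, ∃ v ∉ ({s, u, w} : Finset (Fin n)),
      DirEdge f s v ∨ DirEdge f v s := by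
    intro f hf u w
    by_contra! hc
    refine hf (Or.inl (Or.inr ⟨(u, w), Finset.mem_univ _, ?_⟩))
    rintro ⟨x, y⟩ hx
    rw [mem_starPairs, Finset.mem_compl, Finset.mem_compl] at hx
    rcases hx with ⟨h1, h2⟩ | ⟨h1, h2⟩ <;> dsimp only at h1 h2 ⊢
    · rw [Finset.mem_singleton.1 h2]
      exact (hc x h1).2
    · rw [Finset.mem_singleton.1 h1]
      exact (hc y h2).1
  have hin : ∀ f ∉ exceptional s a b, ∀ v w, v ≠ a → ∃ u ∉ ({a, b, v, w} : Finset (Fin n)),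
      DirEdge f u a ∨ DirEdge f u v ∨ DirEdge f b u := by
    intro f hf v w hva
    by_contra! hc
    refine hf (Or.inr (Or.inl ⟨(v, w), by simp [hva], ?_⟩))
    rintro ⟨x, y⟩ hx
    rw [mem_starPairs, Finset.mem_compl, Finset.mem_compl] at hx
    rcases hx with ⟨h1, h2⟩ | ⟨h1, h2⟩ <;> dsimp only at h1 h2 ⊢
    · rcases Finset.mem_insert.1 h2 with h2 | h2
      · rw [h2]
        exact (hc x h1).1
      · rw [Finset.mem_singleton.1 h2]
        exact (hc x h1).2.1
    · rw [Finset.mem_singleton.1 h1]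
      exact (hc y h2).2.2
  have hout : ∀ f ∉ exceptional s a b, ∀ v w, v ≠ b → ∃ u ∉ ({a, b, v, w} : Finset (Fin n)),
      DirEdge f u a ∨ DirEdge f b u ∨ DirEdge f v u := by
    intro f hf v w hvb
    by_contra! hc
    refine hf (Or.inr (Or.inr ⟨(v, w), by simp [hvb], ?_⟩))
    rintro ⟨x, y⟩ hx
    rw [mem_starPairs, Finset.mem_compl, Finset.mem_compl] at hx
    rcases hx with ⟨h1, h2⟩ | ⟨h1, h2⟩ <;> dsimp only at h1 h2 ⊢
    · rw [Finset.mem_singleton.1 h2]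
      exact (hc x h1).1
    · rcases Finset.mem_insert.1 h1 with h1 | h1
      · rw [h1]
        exact (hc y h2).2.1
      · rw [Finset.mem_singleton.1 h1]
        exact (hc y h2).2.2
  have hthree : 3 * PrGnm n m {f | ∀ e ∈ F, f e ≠ some (o e)} =
      PrGnm n m (avoids D₁) + PrGnm n m (avoids D₂) + PrGnm n m (avoids D₃) := by
    rw [e1, e2, e3]
    ring
  rw [hthree]
  refine abs_prWeight_sub_three_le gnm_weight_nonneg ?_ ?_ ?_ ?_ <;> intro f hf
  · rw [a1, a2, a3]
    exact ⟨fun h => exists_small_cuts hsa hsb (by simpa using hn) (hcut f hf) (hiso f hf) (hin f hf)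
      (hout f hf) h.1 h.2, fun h => not_reach_of_small_cut hsa hsb hab h⟩
  · rw [a1, a2]
    rintro ⟨h1, h2⟩ ⟨-, h3⟩
    obtain ⟨u, hu, h⟩ := hout f hf s s hsb
    grind
  · rw [a1, a3]
    rintro ⟨h1, h2⟩ ⟨-, h3⟩
    obtain ⟨u, hu, h⟩ := hin f hf s s hsa
    grind
  · rw [a2, a3]
    rintro ⟨h1, h2⟩ ⟨h3, -⟩
    obtain ⟨u, hu, h⟩ := hout f hf s s hsb
    grind

end FiniteBound

section Asymptotics

lemma pow_mul_pow_le_of_two_mul_le {N j : ℕ} {r : ℝ} (hr0 : 0 ≤ r) (hr1 : r ≤ 1)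
    (h : (N : ℝ) * r ^ (N / 2 - 3) ≤ 1) (hj : 3 ≤ j) (hjN : 2 * j ≤ N) :
    (N : ℝ) ^ j * r ^ (j * (N - j)) ≤ N ^ 3 * r ^ (3 * N - 9) := by
  obtain ⟨i, rfl⟩ := Nat.exists_eq_add_of_le hj
  have hexp : (3 * N - 9) + (N / 2 - 3) * i ≤ (3 + i) * (N - (3 + i)) := by
    obtain ⟨d, rfl⟩ := Nat.exists_eq_add_of_le (show 6 + 2 * i ≤ N by omega)
    have h1 : (6 + 2 * i + d) / 2 - 3 ≤ i + d := by omega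
    have h2 := Nat.mul_le_mul_right i h1
    rw [show 6 + 2 * i + d - (3 + i) = 3 + i + d by omega,
      show 3 * (6 + 2 * i + d) - 9 = 9 + 6 * i + 3 * d by omega]
    nlinarith
  calc (N : ℝ) ^ (3 + i) * r ^ ((3 + i) * (N - (3 + i)))
      ≤ (N : ℝ) ^ (3 + i) * r ^ ((3 * N - 9) + (N / 2 - 3) * i) := by
        gcongr ?_ * ?_
        exact pow_le_pow_of_le_one hr0 hr1 hexp
    _ = N ^ 3 * r ^ (3 * N - 9) * (N * r ^ (N / 2 - 3)) ^ i := by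
        rw [pow_add, pow_add, pow_mul, mul_pow]
        ring
    _ ≤ N ^ 3 * r ^ (3 * N - 9) * 1 := by
        gcongr
        exact pow_le_one₀ (by positivity) h
    _ = _ := mul_one _

lemma choose_mul_pow_le {N k : ℕ} {r : ℝ} (hr0 : 0 ≤ r) (hr1 : r ≤ 1)
    (h : (N : ℝ) * r ^ (N / 2 - 3) ≤ 1) (hk : 3 ≤ k) (hkN : k + 3 ≤ N) :
    (N.choose k : ℝ) * r ^ (k * (N - k)) ≤ N ^ 3 * r ^ (3 * N - 9) := by
  have key : ∀ j, 3 ≤ j → 2 * j ≤ N →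
      (N.choose j : ℝ) * r ^ (j * (N - j)) ≤ N ^ 3 * r ^ (3 * N - 9) := by
    intro j h3 hj
    refine le_trans ?_ (pow_mul_pow_le_of_two_mul_le hr0 hr1 h h3 hj)
    gcongr
    exact_mod_cast Nat.choose_le_pow N j
  rcases le_total (2 * k) N with h2 | h2
  · exact key k hk h2
  · have := key (N - k) (by omega) (by omega)
    rwa [Nat.choose_symm (by omega), Nat.sub_sub_self (by omega), mul_comm (N - k) k] at this

lemma sum_choose_mul_pow_le {N : ℕ} {r : ℝ} (hr0 : 0 ≤ r) (hr1 : r ≤ 1)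
    (h : (N : ℝ) * r ^ (N / 2 - 3) ≤ 1) :
    ∑ k ∈ (Finset.range (N + 1)).filter (fun k => 3 ≤ k ∧ k + 3 ≤ N),
      (N.choose k : ℝ) * r ^ (k * (N - k)) ≤ (N + 1) * (N ^ 3 * r ^ (3 * N - 9)) := by
  refine (Finset.sum_le_card_nsmul _ _ (N ^ 3 * r ^ (3 * N - 9)) fun k hk => ?_).trans ?_
  · obtain ⟨-, h3, h4⟩ := Finset.mem_filter.1 hk
    exact choose_mul_pow_le hr0 hr1 h h3 h4
  · rw [nsmul_eq_mul]
    gcongr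
    have := Finset.card_filter_le (Finset.range (N + 1)) (fun k => 3 ≤ k ∧ k + 3 ≤ N)
    rw [Finset.card_range] at this
    exact_mod_cast this

lemma prGnp_exceptional_le_mul {N : ℕ} {p c : ℝ} (hc0 : 0 < c) (hcp : c ≤ p) (hp1 : p ≤ 1)
    (hN : 12 ≤ N) (h : (N : ℝ) * (1 - c ^ 2 / 4) ^ (N / 2 - 3) ≤ 1) (s a b : Fin N) :
    PrGnp N p (exceptional s a b) ≤
      68 * N ^ 4 * (1 - c ^ 2 / 4) ^ (N - 12) * (1 - p / 2) ^ (2 * N) := by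
  set σ := 1 - c ^ 2 / 4 with hσ
  set r := 1 - p / 2 with hr
  have hr0 : 1 / 2 ≤ r := by linarith
  have hr0' : 0 ≤ r := by linarith
  have hr1 : r ≤ 1 := by linarith
  have hrσ : r ≤ σ := by nlinarith
  have hσ0 : 0 ≤ σ := hr0'.trans hrσ
  have hσ1 : σ ≤ 1 := by nlinarith
  have h0 : 0 ≤ p := hc0.le.trans hcp
  have hN' : (12 : ℝ) ≤ N := by exact_mod_cast hN
  have hcut := sum_choose_mul_pow_le (N := N) hr0' hr1
    (le_trans (by gcongr) h)
  have hpow : ∀ e, 3 * N - 12 ≤ e → r ^ e ≤ σ ^ (N - 12) * r ^ (2 * N) := by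
    intro e he
    calc r ^ e ≤ r ^ ((N - 12) + 2 * N) := pow_le_pow_of_le_one hr0' hr1 (by omega)
      _ = r ^ (N - 12) * r ^ (2 * N) := pow_add _ _ _
      _ ≤ _ := by gcongr
  have hsym : (1 - p) ^ (N - 3) ≤ 64 * (σ ^ (N - 12) * r ^ (2 * N)) := by
    have h1 : 1 - p ≤ r ^ 2 * σ := by
      have h2 : c * r ≤ p := by nlinarith
      have h3 : (c * r) ^ 2 ≤ p ^ 2 := by gcongr
      rw [hσ, hr] at *
      nlinarith
    calc (1 - p) ^ (N - 3) ≤ (r ^ 2 * σ) ^ (N - 3) := by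
          gcongr
      _ = r ^ (2 * (N - 3)) * σ ^ (N - 3) := by rw [mul_pow, ← pow_mul]
      _ ≤ r ^ (2 * (N - 3)) * σ ^ (N - 12) := by
          gcongr ?_ * ?_
          exact pow_le_pow_of_le_one hσ0 hσ1 (by omega)
      _ ≤ (64 * r ^ 6) * (r ^ (2 * (N - 3)) * σ ^ (N - 12)) := by
          refine le_mul_of_one_le_left (by positivity) ?_
          have : (1 / 2 : ℝ) ^ 6 ≤ r ^ 6 := by gcongr
          norm_num at this ⊢
          linarith
      _ = 64 * (σ ^ (N - 12) * r ^ (2 * (N - 3) + 6)) := by ring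
      _ = _ := by rw [show 2 * (N - 3) + 6 = 2 * N by omega]
  have hX : 0 ≤ σ ^ (N - 12) * r ^ (2 * N) := by positivity
  refine (prGnp_exceptional_le h0 hp1 s a b).trans ?_
  calc _ ≤ ((N : ℝ) + 1) * (N ^ 3 * (σ ^ (N - 12) * r ^ (2 * N))) +
        N ^ 2 * (64 * (σ ^ (N - 12) * r ^ (2 * N))) +
        2 * (N ^ 2 * (σ ^ (N - 12) * r ^ (2 * N))) := by
        refine add_le_add (add_le_add (hcut.trans ?_) ?_) ?_
        · gcongr
          exact hpow _ (by omega)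
        · gcongr
        · gcongr
          exact hpow _ (by omega)
    _ = ((N : ℝ) ^ 4 + N ^ 3 + 66 * N ^ 2) * (σ ^ (N - 12) * r ^ (2 * N)) := by ring
    _ ≤ (68 * N ^ 4) * (σ ^ (N - 12) * r ^ (2 * N)) := by
        gcongr
        have h1 : (N : ℝ) ^ 3 ≤ N ^ 4 := pow_le_pow_right₀ (by linarith) (by norm_num)
        have h2 : (N : ℝ) ^ 2 ≤ N ^ 4 := pow_le_pow_right₀ (by linarith) (by norm_num)
        linarith
    _ = _ := by ring

lemma abs_prGnm_sub_three_div_le {N m : ℕ} {c : ℝ} (hc0 : 0 < c)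
    (hcp : c ≤ (m : ℝ) / N.choose 2) (hm : m ≤ N.choose 2)
    (hN : 12 ≤ N) (h : (N : ℝ) * (1 - c ^ 2 / 4) ^ (N / 2 - 3) ≤ 1) {s a b : Fin N}
    (hsa : s ≠ a) (hsb : s ≠ b) (hab : a ≠ b) (F : Finset (Edge N)) (hF : F.card = 2 * N - 3)
    (o : Edge N → Bool) :
    |(PrGnm N m {f | ¬ Reaches f s a ∧ ¬ Reaches f b s} -
        3 * PrGnm N m {f | ∀ e ∈ F, f e ≠ some (o e)}) /
        (1 - (m : ℝ) / N.choose 2 / 2) ^ (2 * N)| ≤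
      408 * (N ^ 6 * (1 - c ^ 2 / 4) ^ (N - 12)) := by
  have hM : 0 < N.choose 2 := Nat.choose_pos (by omega)
  have hp1 : (m : ℝ) / N.choose 2 ≤ 1 := div_le_one_of_le₀ (by exact_mod_cast hm) (by positivity)
  have hσ : 0 ≤ 1 - c ^ 2 / 4 := by nlinarith
  have hr : 0 < 1 - (m : ℝ) / N.choose 2 / 2 := by linarith
  rw [abs_div, abs_of_pos (pow_pos hr (2 * N)), div_le_iff₀ (pow_pos hr _)]
  refine (abs_prGnm_sub_three_le (by omega) hsa hsb hab F hF o).trans ?_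
  have hchoose : (N.choose 2 : ℝ) + 1 ≤ 2 * N ^ 2 := by
    have h1 : (N.choose 2 : ℝ) ≤ N ^ 2 := by exact_mod_cast Nat.choose_le_pow N 2
    have h2 : (12 : ℝ) ≤ N := by exact_mod_cast hN
    nlinarith
  calc 3 * PrGnm N m (exceptional s a b)
      ≤ 3 * ((N.choose 2 + 1) * PrGnp N ((m : ℝ) / N.choose 2) (exceptional s a b)) := by
        gcongr
        exact prGnm_le_prGnp hM hm _
    _ ≤ 3 * ((2 * N ^ 2) * (68 * N ^ 4 * (1 - c ^ 2 / 4) ^ (N - 12) *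
          (1 - (m : ℝ) / N.choose 2 / 2) ^ (2 * N))) := by
        refine mul_le_mul_of_nonneg_left ?_ (by norm_num)
        refine (mul_le_mul_of_nonneg_left (prGnp_exceptional_le_mul hc0 hcp hp1 hN h s a b)
          (by positivity)).trans ?_
        gcongr
    _ = _ := by ring

lemma abs_prGnm_avoid_div_sub_exp_le {N m : ℕ} (hm : m ≤ N.choose 2) (hN : 12 ≤ N)
    (F : Finset (Edge N)) (hF : F.card = 2 * N - 3) (o : Edge N → Bool) :
    |PrGnm N m {f | ∀ e ∈ F, f e ≠ some (o e)} / (1 - (m : ℝ) / N.choose 2 / 2) ^ (2 * N - 3) -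
        exp (-(4 * ((m : ℝ) / N.choose 2) * (1 - (m : ℝ) / N.choose 2)) /
          (2 - (m : ℝ) / N.choose 2) ^ 2)| ≤ 432 / √N := by
  have hM : 0 < N.choose 2 := Nat.choose_pos (by omega)
  have hN' : (12 : ℝ) ≤ N := by exact_mod_cast hN
  have hMe : (N.choose 2 : ℝ) = N * (N - 1) / 2 := Nat.cast_choose_two ℝ N
  have hMlow : (N : ℝ) ^ 2 / 4 ≤ N.choose 2 := by
    rw [hMe]
    nlinarith
  have hℓe : ((2 * N - 3 : ℕ) : ℝ) = 2 * N - 3 := by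
    rw [Nat.cast_sub (by omega)]
    push_cast
    ring
  have hℓM : 2 * (2 * N - 3) ≤ N.choose 2 := by
    have : (2 : ℝ) * ((2 * N - 3 : ℕ) : ℝ) ≤ N.choose 2 := by
      rw [hℓe, hMe]
      nlinarith
    exact_mod_cast this
  have hp0 : (0 : ℝ) ≤ (m : ℝ) / N.choose 2 := by positivity
  have hp1 : (m : ℝ) / N.choose 2 ≤ 1 := div_le_one_of_le₀ (by exact_mod_cast hm) (by positivity)
  have h1 := abs_avoid_sum_sub_exp_le hM hm (ℓ := 2 * N - 3) (by omega) hℓM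
  rw [prGnm_avoid, hF]
  set p : ℝ := (m : ℝ) / N.choose 2 with hp
  set θ : ℝ := p * (1 - p) / (2 - p) ^ 2 with hθ
  have hθ0 : 0 ≤ θ := div_nonneg (mul_nonneg hp0 (by linarith)) (sq_nonneg _)
  have hθ1 : θ ≤ 1 := by
    refine div_le_one_of_le₀ ?_ (sq_nonneg _)
    nlinarith
  rw [show -(4 * p * (1 - p)) / (2 - p) ^ 2 = -(4 * θ) by rw [hθ]; ring]
  have h2 := abs_exp_neg_sub_exp_neg_le
    (a := ((2 * N - 3 : ℕ) : ℝ) ^ 2 / (2 * N.choose 2) * θ) (b := 4 * θ)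
    (by positivity) (by positivity)
  have hs : √(N : ℝ) * √N = N := Real.mul_self_sqrt (by positivity)
  have hs0 : 0 < √(N : ℝ) := Real.sqrt_pos.2 (by linarith)
  have hs1 : 1 ≤ √(N : ℝ) := Real.one_le_sqrt.2 (by linarith)
  have hinv : 1 / (N : ℝ) ≤ 1 / √N := by
    refine one_div_le_one_div_of_le hs0 ?_
    nlinarith
  have b1 : 3 * ((2 * N - 3 : ℕ) : ℝ) ^ 3 / (N.choose 2 : ℝ) ^ 2 ≤ 384 * (1 / (N : ℝ)) := by
    calc _ ≤ 3 * (2 * (N : ℝ)) ^ 3 / ((N : ℝ) ^ 2 / 4) ^ 2 := by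
          gcongr
          rw [hℓe]
          linarith
      _ = _ := by
          field_simp
          norm_num
  have b2 : 2 * (((2 * N - 3 : ℕ) : ℝ) * √((2 * N - 3 : ℕ) : ℝ)) / N.choose 2 ≤
      32 * (1 / √N) := by
    have h3 : √((2 * N - 3 : ℕ) : ℝ) ≤ 2 * √N := by
      rw [Real.sqrt_le_left (by positivity), mul_pow, sq (√(N : ℝ)), hs, hℓe]
      linarith
    calc _ ≤ 2 * ((2 * (N : ℝ)) * (2 * √N)) / ((N : ℝ) ^ 2 / 4) := by
          gcongr
          rw [hℓe]
          linarith
      _ = 32 * (√N / N) := by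
          field_simp
          norm_num
      _ = _ := by rw [Real.sqrt_div_self']
  have b3 : |((2 * N - 3 : ℕ) : ℝ) ^ 2 / (2 * N.choose 2) * θ - 4 * θ| ≤
      16 * (1 / (N : ℝ)) := by
    have h4 : ((2 * N - 3 : ℕ) : ℝ) ^ 2 / (2 * N.choose 2) - 4 =
        -((8 * N - 9) / (N * (N - 1))) := by
      have : (N : ℝ) - 1 ≠ 0 := by linarith
      have : (N : ℝ) ≠ 0 := by linarith
      rw [hℓe, hMe]
      field_simp
      ring
    have h5 : 0 ≤ (8 * (N : ℝ) - 9) / (N * (N - 1)) :=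
      div_nonneg (by linarith) (mul_nonneg (by linarith) (by linarith))
    rw [← sub_mul, h4, abs_mul, abs_neg, abs_of_nonneg hθ0, abs_of_nonneg h5]
    refine (mul_le_of_le_one_right h5 hθ1).trans ?_
    rw [mul_one_div, div_le_div_iff₀ (by nlinarith) (by linarith)]
    nlinarith
  calc _ ≤ _ := abs_sub_le _ _ _
    _ ≤ _ := add_le_add h1 (h2.trans b3)
    _ ≤ 432 * (1 / √N) := by linarith
    _ = _ := mul_one_div _ _

lemma abs_div_three_mul_sub_one_le {P Q r e δ ε : ℝ} {N : ℕ} (hN : 3 ≤ 2 * N) (hr0 : 0 < r)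
    (hr1 : r ≤ 1) (he : 1 / 3 ≤ e) (h1 : |(P - 3 * Q) / r ^ (2 * N)| ≤ δ)
    (h2 : |Q / r ^ (2 * N - 3) - e| ≤ ε) :
    |P / (3 * r ^ (2 * N - 3) * e) - 1| ≤ δ + 3 * ε := by
  have he0 : 0 < e := by linarith
  have hpow : r ^ (2 * N) = r ^ (2 * N - 3) * r ^ 3 := by
    rw [← pow_add]
    congr 1
    omega
  have hr3 : r ^ 3 ≤ 1 := pow_le_one₀ hr0.le hr1
  have hrpos : 0 < r ^ 3 := by positivity
  have hrℓ : 0 < r ^ (2 * N - 3) := by positivity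
  have heq : P / (3 * r ^ (2 * N - 3) * e) - 1 =
      (P - 3 * Q) / r ^ (2 * N) * (r ^ 3 / (3 * e)) + (Q / r ^ (2 * N - 3) - e) * (1 / e) := by
    rw [hpow]
    field_simp
    ring
  rw [heq]
  refine (abs_add_le _ _).trans (add_le_add ?_ ?_)
  · rw [abs_mul, abs_of_pos (show 0 < r ^ 3 / (3 * e) by positivity)]
    refine (mul_le_of_le_one_right (abs_nonneg _) ?_).trans h1
    exact div_le_one_of_le₀ (by linarith) (by positivity)
  · rw [abs_mul, abs_of_pos (show 0 < 1 / e by positivity), mul_comm]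
    refine mul_le_mul ?_ h2 (abs_nonneg _) (by norm_num)
    rw [div_le_iff₀ he0]
    linarith

lemma one_third_le_exp {p : ℝ} (h1 : p ≤ 1) :
    1 / 3 ≤ exp (-(4 * p * (1 - p)) / (2 - p) ^ 2) := by
  have h2 : -1 ≤ -(4 * p * (1 - p)) / (2 - p) ^ 2 := by
    rw [le_div_iff₀ (by nlinarith)]
    nlinarith [sq_nonneg (5 * p - 4)]
  refine le_trans ?_ (exp_le_exp.2 h2)
  rw [exp_neg, ← one_div]
  exact one_div_le_one_div_of_le (exp_pos 1) (by linarith [exp_one_lt_d9])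

lemma tendsto_pow_mul_pow_sub {σ : ℝ} (h0 : 0 < σ) (h1 : σ < 1) (k d : ℕ) :
    Tendsto (fun N : ℕ => (N : ℝ) ^ k * σ ^ (N - d)) atTop (nhds 0) := by
  have h := (tendsto_pow_const_mul_const_pow_of_abs_lt_one k
    (r := σ) (by rwa [abs_of_pos h0])).div_const (σ ^ d)
  rw [zero_div] at h
  refine h.congr' ?_
  filter_upwards [eventually_ge_atTop d] with N hN
  rw [pow_sub₀ _ h0.ne' hN, div_eq_mul_inv, mul_assoc]

lemma eventually_mul_pow_half_le_one {σ : ℝ} (h0 : 0 < σ) (h1 : σ < 1) :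
    ∀ᶠ N : ℕ in atTop, (N : ℝ) * σ ^ (N / 2 - 3) ≤ 1 := by
  have h := ((tendsto_pow_mul_pow_sub h0 h1 1 3).const_mul 3).comp
    (Nat.tendsto_div_const_atTop (n := 2) (by norm_num))
  rw [mul_zero] at h
  filter_upwards [h.eventually (eventually_le_nhds one_pos), eventually_ge_atTop 2] with N hN h2
  refine le_trans ?_ hN
  simp only [Function.comp, pow_one]
  rw [← mul_assoc]
  gcongr
  have : N ≤ 3 * (N / 2) := by omega
  exact_mod_cast this

end Asymptotics

/-- Suppose `m = m(n) → ∞`, let `p(n) := m(n)/C(n,2)` and assume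
`liminf p(n) > 0`. For distinct vertices `s, a, b` of `⃗G(n,m)` (graphs on `n + 3`
vertices) and any family of `2n - 3` directed edges (a set `F` of pairs with chosen
orientations `o`, so `q(2n-3;n,m)` is its avoidance probability),
`P(s ↛ a and b ↛ s) = 3 q(2n-3;n,m) + o((1-p/2)^(2n))`, and consequently
`P(s ↛ a and b ↛ s) ∼ 3 (1-p/2)^(2n-3) exp(-4p(1-p)/(2-p)²)`. -/
theorem gnm_joint_not_reach_asymp
    (m : ℕ → ℕ) (hmN : ∀ n, m n ≤ Nat.choose (n + 3) 2)
    (hm : Filter.Tendsto m Filter.atTop Filter.atTop)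
    (hliminf : 0 < Filter.liminf
      (fun n : ℕ => (m n : ℝ) / (Nat.choose (n + 3) 2 : ℝ)) Filter.atTop)
    (s a b : (n : ℕ) → Fin (n + 3))
    (hsa : ∀ n, s n ≠ a n) (hsb : ∀ n, s n ≠ b n) (hab : ∀ n, a n ≠ b n)
    (F : (n : ℕ) → Finset (Edge (n + 3))) (hF : ∀ n, (F n).card = 2 * (n + 3) - 3)
    (o : (n : ℕ) → Edge (n + 3) → Bool) :
    Filter.Tendsto (fun n : ℕ =>
        (PrGnm (n + 3) (m n) {f | ¬ Reaches f (s n) (a n) ∧ ¬ Reaches f (b n) (s n)} -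
            3 * PrGnm (n + 3) (m n) {f | ∀ e ∈ F n, f e ≠ some (o n e)}) /
          (1 - ((m n : ℝ) / (Nat.choose (n + 3) 2 : ℝ)) / 2) ^ (2 * (n + 3)))
      Filter.atTop (nhds 0) ∧
    Filter.Tendsto (fun n : ℕ =>
        PrGnm (n + 3) (m n) {f | ¬ Reaches f (s n) (a n) ∧ ¬ Reaches f (b n) (s n)} /
          (3 * (1 - ((m n : ℝ) / (Nat.choose (n + 3) 2 : ℝ)) / 2) ^ (2 * (n + 3) - 3) *
            Real.exp (-(4 * ((m n : ℝ) / (Nat.choose (n + 3) 2 : ℝ)) *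
                (1 - (m n : ℝ) / (Nat.choose (n + 3) 2 : ℝ))) /
              (2 - (m n : ℝ) / (Nat.choose (n + 3) 2 : ℝ)) ^ 2)))
      Filter.atTop (nhds 1) := by
  obtain ⟨c, hc0, hc1, hcp⟩ : ∃ c : ℝ, 0 < c ∧ c ≤ 1 ∧
      ∀ᶠ n in atTop, c ≤ (m n : ℝ) / (Nat.choose (n + 3) 2 : ℝ) := by
    obtain ⟨c, hc0, hc⟩ := exists_between hliminf
    refine ⟨min c 1, lt_min hc0 one_pos, min_le_right _ _, ?_⟩
    have hbdd : IsBoundedUnder (· ≥ ·) atTop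
        (fun n : ℕ => (m n : ℝ) / (Nat.choose (n + 3) 2 : ℝ)) :=
      isBoundedUnder_of ⟨0, fun n => by positivity⟩
    filter_upwards [eventually_lt_of_lt_liminf hc hbdd] with n hn
    exact (min_le_left _ _).trans hn.le
  have hσ0 : 0 < 1 - c ^ 2 / 4 := by nlinarith
  have hσ1 : 1 - c ^ 2 / 4 < 1 := by nlinarith
  have hshift : Tendsto (fun n : ℕ => n + 3) atTop atTop := tendsto_add_atTop_nat 3
  have hp1 : ∀ n, (m n : ℝ) / (Nat.choose (n + 3) 2 : ℝ) ≤ 1 := fun n =>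
    div_le_one_of_le₀ (by exact_mod_cast hmN n) (by positivity)
  have hp0 : ∀ n, 0 ≤ (m n : ℝ) / (Nat.choose (n + 3) 2 : ℝ) := fun n => by positivity
  have hδ := ((tendsto_pow_mul_pow_sub hσ0 hσ1 6 12).const_mul 408).comp hshift
  rw [mul_zero] at hδ
  have hε : Tendsto (fun n : ℕ => 432 / √((n + 3 : ℕ) : ℝ)) atTop (nhds 0) :=
    tendsto_const_nhds.div_atTop
      (tendsto_sqrt_atTop.comp (tendsto_natCast_atTop_atTop.comp hshift))
  have hdiff : ∀ᶠ n : ℕ in atTop,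
      |(PrGnm (n + 3) (m n) {f | ¬ Reaches f (s n) (a n) ∧ ¬ Reaches f (b n) (s n)} -
        3 * PrGnm (n + 3) (m n) {f | ∀ e ∈ F n, f e ≠ some (o n e)}) /
        (1 - ((m n : ℝ) / (Nat.choose (n + 3) 2 : ℝ)) / 2) ^ (2 * (n + 3))| ≤
      408 * (((n + 3 : ℕ) : ℝ) ^ 6 * (1 - c ^ 2 / 4) ^ (n + 3 - 12)) := by
    filter_upwards [hcp, hshift.eventually (eventually_mul_pow_half_le_one hσ0 hσ1),
      eventually_ge_atTop 9] with n h1 h2 h3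
    exact abs_prGnm_sub_three_div_le hc0 h1 (hmN n) (by omega) h2 (hsa n) (hsb n) (hab n) (F n)
      (hF n) (o n)
  refine ⟨squeeze_zero_norm' hdiff hδ, ?_⟩
  rw [tendsto_iff_norm_sub_tendsto_zero]
  have hsum := hδ.add (hε.const_mul 3)
  rw [mul_zero, add_zero] at hsum
  refine squeeze_zero' (Eventually.of_forall fun n => norm_nonneg _) ?_ hsum
  filter_upwards [hdiff, eventually_ge_atTop 9] with n h1 h2
  exact abs_div_three_mul_sub_one_le (by omega) (by linarith [hp1 n]) (by linarith [hp0 n])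
    (one_third_le_exp (hp1 n)) h1
    (abs_prGnm_avoid_div_sub_exp_le (hmN n) (by omega) (F n) (hF n) (o n))
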